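/- arXiv:1507.03395 — 5 statements merged into one kernel-verified Lean document; each statement's English description precedes it below -/
import Mathlib

section
/- MSB LP Excess Lemma (LP decoder form). Let ch = (Σ, p, *) be a discrete MSB channel with LLR distribution μ given input 0. For each blocklength n (along an infinite sequence), let P_n ⊆ [0,1]^n be a convex polytope with 0 ∈ P_n, and say the P_n-LP decoder succeeds on l ∈ ℝ^n if ⟨x, l⟩ > 0 for every nonzero x ∈ P_n (equivalently, 0 is the unique minimizer of ⟨x, l⟩ over P_n). Suppose there exists α > 0 such that for every α-distortion ch' of ch, with LLR distribution μ' given input 0, one has lim_{n→∞} Pr_{l ~ μ'^n}[the P_n-LP decoder succeeds on l] = 1. Then there exists ε > 0 such that lim_{n→∞} Pr_{l ~ μ^n}[the P_n-LP decoder succeeds on l − ε𝟙] = 1, where 𝟙 ∈ ℝ^n is the all-ones vector. -/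
open Finset Filter

/-- The log-likelihood-ratio map of a channel with output distribution `p` (given input 0)
and pairing involution `st`: `L(a) = ln (p a / p (a*))`. -/
noncomputable def LLR {S : Type*} (p : S → ℝ) (st : S → S) (a : S) : ℝ :=
  Real.log (p a / p (st a))

/-- The probability, under the `n`-fold product of the output distribution `p` (given input 0),
that the LLR vector of the received word lies in the set `C`. -/
noncomputable def llrProb {S : Type*} [Fintype S] (p : S → ℝ) (st : S → S) {n : ℕ}
    (C : Set (Fin n → ℝ)) : ℝ :=
  ∑ y : Fin n → S, (∏ i, p (y i)) *
    Set.indicator C (fun _ => (1 : ℝ)) (fun i => LLR p st (y i))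

/-- The `P`-LP decoder succeeds on LLR vector `l` if `⟨x, l⟩ > 0` for every nonzero `x ∈ P`. -/
def LPsucceeds {n : ℕ} (P : Set (Fin n → ℝ)) (l : Fin n → ℝ) : Prop :=
  ∀ x ∈ P, x ≠ 0 → 0 < ∑ i, x i * l i

lemma LLR_st {S : Type*} (p : S → ℝ) (st : S → S) (hst : ∀ a, st (st a) = a) (a : S) :
    LLR p st (st a) = -LLR p st a := by
  unfold LLR
  rw [hst, ← Real.log_inv, inv_div]

/-- The probability that the LLR vector of the received word avoids `C`. -/
lemma one_sub_llrProb {S : Type*} [Fintype S] {p : S → ℝ} (st : S → S)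
    (hp_sum : ∑ a, p a = 1) {n : ℕ} (C : Set (Fin n → ℝ)) :
    1 - llrProb p st C = ∑ y : Fin n → S, (∏ i, p (y i)) *
      Set.indicator Cᶜ (fun _ => (1 : ℝ)) (fun i => LLR p st (y i)) := by
  classical
  have h1 : ∑ y : Fin n → S, ∏ i, p (y i) = 1 := by
    rw [← Fintype.prod_sum]
    simp [hp_sum]
  nth_rw 1 [← h1]
  rw [llrProb, ← Finset.sum_sub_distrib]
  refine Finset.sum_congr rfl fun y _ => ?_
  by_cases h : (fun i => LLR p st (y i)) ∈ C <;> simp [h]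

lemma llrProb_le_one {S : Type*} [Fintype S] {p : S → ℝ} (st : S → S)
    (hp : ∀ a, 0 ≤ p a) (hp_sum : ∑ a, p a = 1) {n : ℕ} (C : Set (Fin n → ℝ)) :
    llrProb p st C ≤ 1 := by
  have h : 0 ≤ 1 - llrProb p st C := by
    rw [one_sub_llrProb st hp_sum]
    refine Finset.sum_nonneg fun y _ => mul_nonneg (Finset.prod_nonneg fun i _ => hp _) ?_
    exact Set.indicator_nonneg (fun _ _ => zero_le_one) _
  linarith

/-- The conditional expectation of a function of one coordinate of the output of a memoryless
channel with transition matrix `W`. -/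
lemma sum_prod_mul_apply {S T : Type*} [Fintype T] {W : S → T → ℝ}
    (hW : ∀ a, ∑ b, W a b = 1) (f : T → ℝ) {n : ℕ} (y : Fin n → S) (i : Fin n) :
    ∑ z : Fin n → T, (∏ j, W (y j) (z j)) * f (z i) = ∑ b, W (y i) b * f b := by
  classical
  have h : ∀ z : Fin n → T, (∏ j, W (y j) (z j)) * f (z i)
      = ∏ j, (W (y j) (z j) * if j = i then f (z j) else 1) := by
    intro z
    rw [Finset.prod_mul_distrib]
    simp
  simp_rw [h]
  rw [← Fintype.prod_sum fun j b => W (y j) b * if j = i then f b else 1,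
    Fintype.prod_eq_single i]
  · simp
  · intro j hj
    simp [hj, hW]

/-- If, given `y`, the output of a memoryless channel leads to decoding failure with small
probability, then averaging the LLR vectors of the successful outputs shows that the decoder
succeeds on a shift of the LLR vector of `y`. -/
lemma LPsucceeds_of_failure_lt {S T : Type*} [Fintype T] {W : S → T → ℝ}
    (hW0 : ∀ a b, 0 ≤ W a b) (hW : ∀ a, ∑ b, W a b = 1) {f : S → ℝ} {g : T → ℝ}
    {c d M δ : ℝ} (hc : 0 < c) (hM : ∀ b, |g b| ≤ M) (hM0 : 0 ≤ M)
    (hδ1 : δ ≤ 1) (hδ : M * δ ≤ c * (d / 2))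
    (hmean : ∀ a, ∑ b, W a b * g b = c * (f a - d))
    {n : ℕ} {P : Set (Fin n → ℝ)} (hP : ∀ x ∈ P, ∀ i, 0 ≤ x i) (y : Fin n → S)
    (hy : ∑ z : Fin n → T, (∏ j, W (y j) (z j)) *
      Set.indicator {l | LPsucceeds P l}ᶜ (fun _ => (1 : ℝ)) (fun i => g (z i)) < δ) :
    LPsucceeds P (fun i => f (y i) - d / 2) := by
  classical
  set w : (Fin n → T) → ℝ := fun z => ∏ j, W (y j) (z j) with hw
  set F : (Fin n → T) → ℝ := fun z =>
    Set.indicator {l | LPsucceeds P l}ᶜ (fun _ => (1 : ℝ)) (fun i => g (z i)) with hF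
  have hw0 : ∀ z, 0 ≤ w z := fun z => Finset.prod_nonneg fun j _ => hW0 _ _
  have hw1 : ∑ z, w z = 1 := by
    rw [hw, ← Fintype.prod_sum fun j b => W (y j) b]
    simp [hW]
  have hF0 : ∀ z, 0 ≤ F z := fun z => Set.indicator_nonneg (fun _ _ => zero_le_one) _
  have hF01 : ∀ z, LPsucceeds P (fun i => g (z i)) ∧ F z = 0 ∨ F z = 1 := by
    intro z
    by_cases h : LPsucceeds P (fun i => g (z i))
    · left; simp [hF, h]
    · right; simp [hF, h]
  have hfail : ∑ z, w z * F z < δ := hy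
  have hsucc : 0 < ∑ z, w z * (1 - F z) := by
    simp only [mul_sub, mul_one, Finset.sum_sub_distrib]
    linarith
  intro x hx hx0
  have hnonneg : ∀ z, 0 ≤ w z * (1 - F z) * ∑ i, x i * g (z i) := by
    intro z
    rcases hF01 z with ⟨hz, h0⟩ | h1
    · exact mul_nonneg (by simpa [h0] using hw0 z) (hz x hx hx0).le
    · simp [h1]
  have hpos : 0 < ∑ z, w z * (1 - F z) * ∑ i, x i * g (z i) := by
    obtain ⟨z, -, hz⟩ := Finset.exists_lt_of_sum_lt
      (show ∑ z : Fin n → T, (0 : ℝ) < ∑ z, w z * (1 - F z) by simpa using hsucc)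
    refine Finset.sum_pos' (fun z _ => hnonneg z) ⟨z, Finset.mem_univ _, mul_pos hz ?_⟩
    rcases hF01 z with ⟨h, -⟩ | h
    · exact h x hx hx0
    · simp [h] at hz
  have hcoord : ∀ i, ∑ z, w z * (1 - F z) * g (z i) ≤ c * (f (y i) - d / 2) := by
    intro i
    have h1 : ∑ z, w z * g (z i) = c * (f (y i) - d) := by
      rw [← hmean, ← sum_prod_mul_apply hW g y i]
    have h2 : ∑ z, w z * F z * -g (z i) ≤ M * δ := by
      calc ∑ z, w z * F z * -g (z i) ≤ ∑ z, w z * F z * M := by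
            refine Finset.sum_le_sum fun z _ => ?_
            refine mul_le_mul_of_nonneg_left ?_ (mul_nonneg (hw0 z) (hF0 z))
            exact (neg_le_abs _).trans (hM _)
        _ = M * ∑ z, w z * F z := by rw [← Finset.sum_mul, mul_comm]
        _ ≤ M * δ := mul_le_mul_of_nonneg_left hfail.le hM0
    have h3 : ∑ z, w z * (1 - F z) * g (z i)
        = ∑ z, w z * g (z i) + ∑ z, w z * F z * -g (z i) := by
      rw [← Finset.sum_add_distrib]
      exact Finset.sum_congr rfl fun z _ => by ring
    rw [h3, h1]
    linarith
  have hswap : ∑ z, w z * (1 - F z) * ∑ i, x i * g (z i)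
      = ∑ i, x i * ∑ z, w z * (1 - F z) * g (z i) := by
    simp only [Finset.mul_sum]
    rw [Finset.sum_comm]
    exact Finset.sum_congr rfl fun i _ => Finset.sum_congr rfl fun z _ => by ring
  have hle : ∑ i, x i * ∑ z, w z * (1 - F z) * g (z i)
      ≤ c * ∑ i, x i * (f (y i) - d / 2) := by
    rw [Finset.mul_sum]
    refine Finset.sum_le_sum fun i _ => ?_
    calc _ ≤ x i * (c * (f (y i) - d / 2)) :=
          mul_le_mul_of_nonneg_left (hcoord i) (hP x hx i)
      _ = _ := by ring
  exact (mul_pos_iff_of_pos_left hc).1 ((hpos.trans_eq hswap).trans_le hle)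

/-- Markov's inequality for the conditional failure probability: passing through a memoryless
channel with transition matrix `W` that shifts the mean LLR down by `d` (up to scaling). -/
lemma one_sub_llrProb_shift_le {S : Type*} [Fintype S] {p p' : S → ℝ} {st : S → S}
    {W : S → S → ℝ} (hp : ∀ a, 0 ≤ p a) (hp_sum : ∑ a, p a = 1) (hp'_sum : ∑ a, p' a = 1)
    (hW0 : ∀ a b, 0 ≤ W a b) (hW : ∀ a, ∑ b, W a b = 1)
    (hpW : ∀ b, ∑ a, p a * W a b = p' b)
    {c d M δ : ℝ} (hc : 0 < c) (hM : ∀ b, |LLR p' st b| ≤ M) (hM0 : 0 ≤ M)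
    (hδ0 : 0 < δ) (hδ1 : δ ≤ 1) (hδ : M * δ ≤ c * (d / 2))
    (hmean : ∀ a, ∑ b, W a b * LLR p' st b = c * (LLR p st a - d))
    {n : ℕ} {P : Set (Fin n → ℝ)} (hP : ∀ x ∈ P, ∀ i, 0 ≤ x i) :
    1 - llrProb p st {l | LPsucceeds P (fun i => l i - d / 2)}
      ≤ (1 - llrProb p' st {l | LPsucceeds P l}) / δ := by
  classical
  set F : (Fin n → S) → ℝ := fun z =>
    Set.indicator {l | LPsucceeds P l}ᶜ (fun _ => (1 : ℝ)) (fun i => LLR p' st (z i)) with hF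
  have hF0 : ∀ z, 0 ≤ F z := fun z => Set.indicator_nonneg (fun _ _ => zero_le_one) _
  have hprod : ∀ z : Fin n → S,
      ∏ i, p' (z i) = ∑ y : Fin n → S, (∏ i, p (y i)) * ∏ i, W (y i) (z i) := by
    intro z
    simp_rw [← hpW, ← Finset.prod_mul_distrib]
    rw [← Fintype.prod_sum fun i a => p a * W a (z i)]
  have hjoint : 1 - llrProb p' st {l | LPsucceeds P l}
      = ∑ y : Fin n → S, (∏ i, p (y i)) *
        ∑ z : Fin n → S, (∏ i, W (y i) (z i)) * F z := by
    rw [one_sub_llrProb st hp'_sum]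
    simp_rw [hprod, Finset.sum_mul, Finset.mul_sum]
    rw [Finset.sum_comm]
    exact Finset.sum_congr rfl fun y _ => Finset.sum_congr rfl fun z _ => by ring
  rw [hjoint, one_sub_llrProb st hp_sum, Finset.sum_div]
  refine Finset.sum_le_sum fun y _ => ?_
  rw [mul_div_assoc]
  refine mul_le_mul_of_nonneg_left ?_ (Finset.prod_nonneg fun i _ => hp _)
  have hs0 : 0 ≤ ∑ z : Fin n → S, (∏ i, W (y i) (z i)) * F z :=
    Finset.sum_nonneg fun z _ =>
      mul_nonneg (Finset.prod_nonneg fun i _ => hW0 _ _) (hF0 z)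
  rcases lt_or_ge (∑ z : Fin n → S, (∏ i, W (y i) (z i)) * F z) δ with h | h
  · have := LPsucceeds_of_failure_lt hW0 hW hc hM hM0 hδ1 hδ hmean hP y h
    rw [Set.indicator_of_notMem (by simpa using this)]
    positivity
  · refine le_trans ?_ ((one_le_div hδ0).2 h)
    exact Set.indicator_le_self' (fun _ _ => zero_le_one) _

/-- The unnormalised tilting factor that scales all LLRs by `1 - κ` while only increasing the
weight of symbols with negative LLR. -/
noncomputable def tilt {S : Type*} (p : S → ℝ) (st : S → S) (κ : ℝ) (a : S) : ℝ :=
  max 1 (Real.exp (-(κ * LLR p st a)))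

lemma tilt_pos {S : Type*} (p : S → ℝ) (st : S → S) (κ : ℝ) (a : S) : 0 < tilt p st κ a :=
  zero_lt_one.trans_le (le_max_left _ _)

lemma LLR_tilt {S : Type*} {p : S → ℝ} {st : S → S} (hst : ∀ a, st (st a) = a)
    (hp : ∀ a, 0 < p a) (κ : ℝ) {Z : ℝ} (hZ : 0 < Z) (a : S) :
    LLR (fun b => p b * tilt p st κ b / Z) st a = (1 - κ) * LLR p st a := by
  have hm : tilt p st κ a = Real.exp (-(κ * LLR p st a)) * tilt p st κ (st a) := by
    unfold tilt
    rw [mul_max_of_nonneg _ _ (Real.exp_nonneg _), LLR_st p st hst, ← Real.exp_add, max_comm]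
    simp
  have h1 := hp a
  have h2 := hp (st a)
  have h3 := tilt_pos p st κ (st a)
  have : p a * tilt p st κ a / Z / (p (st a) * tilt p st κ (st a) / Z)
      = p a / p (st a) * Real.exp (-(κ * LLR p st a)) := by
    rw [hm]
    field_simp
  unfold LLR at this ⊢
  rw [this, Real.log_mul (by positivity) (Real.exp_ne_zero _), Real.log_exp]
  ring

/-- For small tilting parameter the normalised tilted distribution is an `α`-distortion. -/
lemma exists_tilt_close {S : Type*} [Fintype S] {p : S → ℝ} (st : S → S)
    (hp_sum : ∑ a, p a = 1) {α : ℝ} (hα : 0 < α) :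
    ∃ κ : ℝ, 0 < κ ∧ κ < 1 ∧
      ∑ a, |p a - p a * tilt p st κ a / ∑ b, p b * tilt p st κ b| ≤ α := by
  have hcont : ∀ a, Continuous fun κ => tilt p st κ a := by
    intro a
    unfold tilt
    fun_prop
  have hZ0 : ∑ b, p b * tilt p st 0 b = 1 := by simp [tilt, hp_sum]
  have ht : Tendsto (fun κ => ∑ a, |p a - p a * tilt p st κ a / ∑ b, p b * tilt p st κ b|)
      (nhds 0) (nhds 0) := by
    have : ContinuousAt
        (fun κ => ∑ a, |p a - p a * tilt p st κ a / ∑ b, p b * tilt p st κ b|) 0 := by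
      refine tendsto_finsetSum _ fun a _ => ?_
      refine ContinuousAt.abs (continuousAt_const.sub (ContinuousAt.div ?_ ?_ ?_))
      · exact (continuous_const.mul (hcont a)).continuousAt
      · exact (continuous_finsetSum _ fun b _ =>
          continuous_const.mul (hcont b)).continuousAt
      · rw [hZ0]; exact one_ne_zero
    have h := this.tendsto
    rw [hZ0] at h
    simpa [tilt] using h
  have h1 := (ht.eventually_le_const hα).filter_mono
    (nhdsWithin_le_nhds (s := Set.Ioi (0 : ℝ)))
  have h2 : ∀ᶠ κ in nhdsWithin (0 : ℝ) (Set.Ioi 0), κ < 1 :=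
    (eventually_lt_nhds zero_lt_one).filter_mono nhdsWithin_le_nhds
  obtain ⟨κ, h, hlt, hpos⟩ := (h1.and (h2.and self_mem_nhdsWithin)).exists
  exact ⟨κ, hpos, hlt, h⟩

/-- If all LLRs vanish, decoding succeeds with positive probability only for `P ⊆ {0}`. -/
lemma llrProb_eq_one_of_LLR_eq_zero {S : Type*} [Fintype S] {p : S → ℝ} {st : S → S}
    (hp_sum : ∑ a, p a = 1) (hL : ∀ a, LLR p st a = 0) {n : ℕ} {P : Set (Fin n → ℝ)}
    (h : 0 < llrProb p st {l | LPsucceeds P l}) (ε : ℝ) :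
    llrProb p st {l | LPsucceeds P (fun i => l i - ε)} = 1 := by
  have hP : ∀ x ∈ P, x = 0 := by
    intro x hx
    by_contra hx0
    have : ¬ LPsucceeds P (fun _ => (0 : ℝ)) := fun hs => by simpa using hs x hx hx0
    simp [llrProb, hL, this] at h
  have hs : ∀ l, LPsucceeds P l := fun l x hx hx0 => absurd (hP x hx) hx0
  have huniv : {l : Fin n → ℝ | LPsucceeds P (fun i => l i - ε)} = Set.univ :=
    Set.eq_univ_of_forall fun l => hs _
  have := one_sub_llrProb (n := n) st hp_sum Set.univ
  simp only [Set.compl_univ, Set.indicator_empty, mul_zero, Finset.sum_const_zero] at this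
  rw [huniv]
  linarith

/-- **MSB LP Excess Lemma (LP decoder form).**  Let `(S, p, st)` be a discrete MSB channel.
For each blocklength `n`, let `P n ⊆ [0,1]^n` be a convex polytope containing `0`.
If there is an `α > 0` such that for every `α`-distortion `(S, p', st)` of the channel the
probability (under `μ'^n`) that the `P n`-LP decoder succeeds tends to `1`, then there is an
`ε > 0` such that the probability (under `μ^n`) that the `P n`-LP decoder succeeds on
`l - ε𝟙` tends to `1`. -/
theorem msb_lp_excess_decoder {S : Type*} [Fintype S]
    (p : S → ℝ) (st : S → S)
    (hst : ∀ a, st (st a) = a)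
    (hp_pos : ∀ a, 0 < p a) (hp_sum : ∑ a, p a = 1)
    (P : ∀ n : ℕ, Set (Fin n → ℝ))
    (hP01 : ∀ n, ∀ x ∈ P n, ∀ i, x i ∈ Set.Icc (0 : ℝ) 1)
    (hPconv : ∀ n, Convex ℝ (P n))
    (hP0 : ∀ n, (0 : Fin n → ℝ) ∈ P n)
    (hα : ∃ α > (0 : ℝ), ∀ p' : S → ℝ,
      (∀ a, 0 < p' a) → (∑ a, p' a = 1) → (∑ a, |p a - p' a|) ≤ α →
      Tendsto (fun n => llrProb p' st {l | LPsucceeds (P n) l}) atTop (nhds 1)) :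
    ∃ ε > (0 : ℝ),
      Tendsto (fun n => llrProb p st {l : Fin n → ℝ |
          LPsucceeds (P n) (fun i => l i - ε)}) atTop (nhds 1) := by
  classical
  obtain ⟨α, hα0, hα⟩ := hα
  by_cases hL : ∀ a, LLR p st a = 0
  · refine ⟨1, one_pos, tendsto_const_nhds.congr' ?_⟩
    have h := hα p hp_pos hp_sum (by simpa using hα0.le)
    filter_upwards [h.eventually_const_lt zero_lt_one] with n hn
    exact (llrProb_eq_one_of_LLR_eq_zero hp_sum hL hn 1).symm
  obtain ⟨a₀, ha₀⟩ : ∃ a, LLR p st a < 0 := by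
    push Not at hL
    obtain ⟨a, ha⟩ := hL
    rcases lt_or_gt_of_ne ha with h | h
    · exact ⟨a, h⟩
    · exact ⟨st a, by rw [LLR_st p st hst]; linarith⟩
  obtain ⟨κ, hκ0, hκ1, hclose⟩ := exists_tilt_close st hp_sum hα0
  set m := tilt p st κ with hm
  set Z := ∑ b, p b * m b with hZdef
  have hm0 : ∀ a, 0 < m a := tilt_pos p st κ
  have hm1 : ∀ a, 1 ≤ m a := fun a => le_max_left _ _
  have hZ : 0 < Z := Finset.sum_pos (fun b _ => mul_pos (hp_pos b) (hm0 b)) ⟨a₀, mem_univ _⟩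
  set p' : S → ℝ := fun b => p b * m b / Z with hp'
  have hp'_pos : ∀ a, 0 < p' a := fun a => div_pos (mul_pos (hp_pos a) (hm0 a)) hZ
  have hp'_sum : ∑ a, p' a = 1 := by rw [hp', ← Finset.sum_div, div_self hZ.ne']
  have hlim := hα p' hp'_pos hp'_sum hclose
  have hLLR : ∀ a, LLR p' st a = (1 - κ) * LLR p st a := LLR_tilt hst hp_pos κ hZ
  set d := ∑ b, p b * (m b - 1) * -LLR p st b with hd
  have hd0 : 0 < d := by
    refine Finset.sum_pos' (fun b _ => ?_) ⟨a₀, mem_univ _, ?_⟩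
    · rcases le_or_gt (LLR p st b) 0 with h | h
      · exact mul_nonneg (mul_nonneg (hp_pos b).le (sub_nonneg.2 (hm1 b))) (neg_nonneg.2 h)
      · have : m b = 1 := max_eq_left (Real.exp_le_one_iff.2 (by nlinarith))
        simp [this]
    · have : 1 < m a₀ := lt_max_of_lt_right (Real.one_lt_exp_iff.2 (by nlinarith))
      exact mul_pos (mul_pos (hp_pos a₀) (sub_pos.2 this)) (neg_pos.2 ha₀)
  set W : S → S → ℝ := fun a b => ((if a = b then 1 else 0) + p b * (m b - 1)) / Z with hW
  have hW0 : ∀ a b, 0 ≤ W a b := fun a b =>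
    div_nonneg (add_nonneg (by split_ifs <;> norm_num)
      (mul_nonneg (hp_pos b).le (sub_nonneg.2 (hm1 b)))) hZ.le
  have hW1 : ∀ a, ∑ b, W a b = 1 := by
    intro a
    rw [hW, ← Finset.sum_div, div_eq_one_iff_eq hZ.ne', Finset.sum_add_distrib]
    simp [mul_sub, hp_sum, hZdef]
  have hpW : ∀ b, ∑ a, p a * W a b = p' b := by
    intro b
    simp only [hW, hp', ← mul_div_assoc]
    rw [← Finset.sum_div]
    simp only [mul_add, Finset.sum_add_distrib, ← Finset.sum_mul, hp_sum]
    simp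
    ring
  have hc : 0 < (1 - κ) / Z := div_pos (by linarith) hZ
  have hmean : ∀ a, ∑ b, W a b * LLR p' st b = (1 - κ) / Z * (LLR p st a - d) := by
    intro a
    have h : ∀ b, W a b * LLR p' st b = (1 - κ) / Z *
        ((if a = b then LLR p st b else 0) - p b * (m b - 1) * -LLR p st b) := by
      intro b
      rw [hLLR]
      simp only [hW]
      split_ifs <;> ring
    simp_rw [h]
    rw [← Finset.mul_sum, Finset.sum_sub_distrib]
    simp [hd]
  set M := ∑ b, |LLR p' st b| with hMdef
  have hM : ∀ b, |LLR p' st b| ≤ M := fun b =>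
    Finset.single_le_sum (f := fun b => |LLR p' st b|) (fun _ _ => abs_nonneg _) (mem_univ b)
  have hM0 : 0 ≤ M := Finset.sum_nonneg fun _ _ => abs_nonneg _
  set η := (1 - κ) / Z * (d / 2) with hη
  have hη0 : 0 < η := mul_pos hc (half_pos hd0)
  have hδ0 : 0 < min 1 (η / (M + 1)) := lt_min one_pos (by positivity)
  have hδ : M * min 1 (η / (M + 1)) ≤ η := by
    calc M * min 1 (η / (M + 1)) ≤ (M + 1) * (η / (M + 1)) :=
          mul_le_mul (by linarith) (min_le_right _ _) hδ0.le (by linarith)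
      _ = η := by field_simp
  refine ⟨d / 2, half_pos hd0, ?_⟩
  have hlow : Tendsto (fun n => 1 - (1 - llrProb p' st {l | LPsucceeds (P n) l}) /
      min 1 (η / (M + 1))) atTop (nhds 1) := by
    simpa using ((hlim.const_sub 1).div_const (min 1 (η / (M + 1)))).const_sub 1
  refine tendsto_of_tendsto_of_tendsto_of_le_of_le hlow tendsto_const_nhds (fun n => ?_)
    fun n => llrProb_le_one st (fun a => (hp_pos a).le) hp_sum _
  have := one_sub_llrProb_shift_le (st := st) (fun a => (hp_pos a).le) hp_sum hp'_sum hW0 hW1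
    hpW hc hM hM0 hδ0 (min_le_left _ _) hδ hmean (fun x hx i => (hP01 n x hx i).1)
  simp only at this ⊢
  linarith
end

section
/- LLR proportionality of the distorted channel. Let Σ be a finite set, * : Σ → Σ an involution, and p a probability distribution on Σ with p(a) > 0 for all a. Let Σ_- = {a : p(a) < p(a*)} be nonempty, δ ∈ (0,1), and c ∈ (0,1) with Σ_{a∈Σ_-} p(a)·((p(a*)/p(a))^{1−c} − 1) = δ/(1−δ). Define q(a) = ((1−δ)/δ)·p(a)·((p(a*)/p(a))^{1−c} − 1) for a ∈ Σ_-, q(a) = 0 otherwise, and p'(a) = δ·q(a) + (1−δ)·p(a) for a ∈ Σ_-, p'(a) = (1−δ)·p(a) otherwise. Let L(a) = ln(p(a)/p(a*)) and L'(a) = ln(p'(a)/p'(a*)). Then L'(a) = c·L(a) for every a ∈ Σ. -/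
open Finset

/-- **LLR proportionality of the distorted channel.**  With `st` an involution of the finite
set `S`, `p` a strictly positive probability distribution with `Σ_- = {a : p a < p (a*)}`
nonempty, `δ ∈ (0,1)` and `c ∈ (0,1)` satisfying the normalization identity, the trading
distribution `q` and distorted distribution `p'` defined by the stated formulas satisfy
`L'(a) = c · L(a)` for every `a ∈ S`, where `L(a) = ln(p(a)/p(a*))` and
`L'(a) = ln(p'(a)/p'(a*))`. -/
theorem distorted_llr_proportional {S : Type*} [Fintype S]
    (p : S → ℝ) (st : S → S)
    (hst : ∀ a, st (st a) = a)
    (hp_pos : ∀ a, 0 < p a) (hp_sum : ∑ a, p a = 1)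
    (hneg : ∃ a, p a < p (st a))
    (δ : ℝ) (hδ0 : 0 < δ) (hδ1 : δ < 1)
    (c : ℝ) (hc0 : 0 < c) (hc1 : c < 1)
    (hc : ∑ a ∈ univ.filter (fun a => p a < p (st a)),
        p a * ((p (st a) / p a) ^ (1 - c) - 1) = δ / (1 - δ))
    (q : S → ℝ)
    (hq : ∀ a, q a = if p a < p (st a)
      then ((1 - δ) / δ) * p a * ((p (st a) / p a) ^ (1 - c) - 1) else 0)
    (p' : S → ℝ)
    (hp' : ∀ a, p' a = if p a < p (st a)
      then δ * q a + (1 - δ) * p a else (1 - δ) * p a) :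
    ∀ a, Real.log (p' a / p' (st a)) = c * Real.log (p a / p (st a)) := by
  have hδ : 0 < 1 - δ := sub_pos.mpr hδ1
  have hneg_eq : ∀ a, p a < p (st a) →
      p' a = (1 - δ) * (p a * (p (st a) / p a) ^ (1 - c)) := by
    intro a ha
    rw [hp', hq, if_pos ha, if_pos ha]
    field_simp
    ring
  have hpos : ∀ a, 0 < p' a := by
    intro a
    have hpa := hp_pos a
    have hpsa := hp_pos (st a)
    by_cases ha : p a < p (st a)
    · rw [hneg_eq a ha]
      positivity
    · rw [hp', if_neg ha]
      positivity
  have hlog : ∀ a, Real.log (p' a) = Real.log (1 - δ) + Real.log (p a) +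
      if p a < p (st a) then (1 - c) * (Real.log (p (st a)) - Real.log (p a)) else 0 := by
    intro a
    have hpa := hp_pos a
    have hratio := div_pos (hp_pos (st a)) hpa
    split_ifs with ha
    · rw [hneg_eq a ha, Real.log_mul hδ.ne' (by positivity),
        Real.log_mul hpa.ne' (by positivity), Real.log_rpow hratio,
        Real.log_div (hp_pos _).ne' hpa.ne']
      ring
    · rw [hp', if_neg ha, Real.log_mul hδ.ne' hpa.ne', add_zero]
  intro a
  rw [Real.log_div (hpos _).ne' (hpos _).ne', Real.log_div (hp_pos _).ne' (hp_pos _).ne',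
    hlog, hlog, hst]
  rcases lt_trichotomy (p a) (p (st a)) with h | h | h
  · rw [if_pos h, if_neg h.not_gt]
    ring
  · simp [h]
  · rw [if_neg h.not_gt, if_pos h]
    ring
end

section
/- BSC LP Excess Lemma. Let 0 < β < 1/2 and for γ ∈ (0, 1/2) let μ_γ be the probability distribution on ℝ that takes the value ln((1−γ)/γ) with probability 1−γ and the value −ln((1−γ)/γ) with probability γ (the LLR distribution of the γ-BSC given input 0). For each blocklength n (along an infinite sequence), let C_n ⊆ ℝ^n be a convex cone (closed under addition and positive scaling) with C_n + (ℝ≥0)^n ⊆ C_n. Assume there exists β' with β < β' < 1/2 such that lim_{n→∞} μ_{β'}^n(C_n) = 1. Then there exists ε > 0 such that lim_{n→∞} μ_β^n(C_n + ε𝟙) = 1, where 𝟙 ∈ ℝ^n is the all-ones vector. -/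
open Finset Filter

/-- The probability, under the `γ`-BSC given input `0`, that the LLR vector of the received
word lies in `C`: a received bit is flipped (`y i = true`) with probability `γ`, in which
case its LLR is `-ln((1-γ)/γ)`, and otherwise its LLR is `ln((1-γ)/γ)`.  This is
`μ_γ^n(C)` for the BSC LLR distribution `μ_γ`. -/
noncomputable def bscLlrProb (γ : ℝ) {n : ℕ} (C : Set (Fin n → ℝ)) : ℝ :=
  ∑ y : Fin n → Bool,
    (∏ i, if y i then γ else 1 - γ) *
      Set.indicator C (fun _ => (1 : ℝ))
        (fun i => if y i then -Real.log ((1 - γ) / γ) else Real.log ((1 - γ) / γ))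

/-- The probability of the flip pattern `y` when bits are flipped independently with
probability `γ`. -/
noncomputable def flipWeight (γ : ℝ) {n : ℕ} (y : Fin n → Bool) : ℝ :=
  ∏ i, if y i then γ else 1 - γ

/-- The `±1` vector of a flip pattern: `-1` at flipped bits and `1` elsewhere. -/
noncomputable def flipSign {n : ℕ} (y : Fin n → Bool) : Fin n → ℝ :=
  fun i => if y i then -1 else 1

lemma sum_pi_prod_eq_prod_sum {n : ℕ} {α : Type*} [Fintype α] (f : Fin n → α → ℝ) :
    ∑ x : Fin n → α, ∏ i, f i (x i) = ∏ i, ∑ a, f i a := by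
  classical
  rw [Finset.prod_univ_sum, Fintype.piFinset_univ]

lemma flipWeight_pos {γ : ℝ} (h0 : 0 < γ) (h1 : γ < 1) {n : ℕ} (y : Fin n → Bool) :
    0 < flipWeight γ y := by
  refine Finset.prod_pos fun i _ => ?_
  split_ifs <;> linarith

lemma sum_flipWeight (γ : ℝ) (n : ℕ) : ∑ y : Fin n → Bool, flipWeight γ y = 1 := by
  unfold flipWeight
  rw [sum_pi_prod_eq_prod_sum fun _ b => if b = true then γ else 1 - γ]
  simp

lemma sum_flipWeight_marginal (γ : ℝ) {n : ℕ} (i : Fin n) :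
    ∑ y : Fin n → Bool, flipWeight γ y * (if y i then 1 else 0) = γ := by
  have h : ∀ y : Fin n → Bool, flipWeight γ y * (if y i then 1 else 0) =
      ∏ j, (if y j then γ else 1 - γ) * (if j = i then (if y j then 1 else 0) else 1) := by
    intro y
    rw [Finset.prod_mul_distrib, Finset.prod_ite_eq' Finset.univ i, if_pos (Finset.mem_univ i),
      flipWeight]
  simp_rw [h]
  rw [sum_pi_prod_eq_prod_sum fun j b =>
    (if b = true then γ else 1 - γ) * (if j = i then (if b = true then 1 else 0) else 1)]
  have h2 : ∀ j : Fin n, ∑ b : Bool, (if b = true then γ else 1 - γ) *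
      (if j = i then (if b = true then (1 : ℝ) else 0) else 1) = if j = i then γ else 1 := by
    intro j
    by_cases hj : j = i <;> simp [hj]
  simp_rw [h2]
  simp

/-- Flipping with probability `β` and then, independently, setting bits to `true` with
probability `p` has the same effect as flipping with probability `β + (1 - β) * p`. -/
lemma sum_flipWeight_or (β p : ℝ) {n : ℕ} (F : (Fin n → Bool) → ℝ) :
    ∑ y : Fin n → Bool, flipWeight β y *
        ∑ z : Fin n → Bool, flipWeight p z * F (fun i => y i || z i) =
      ∑ x : Fin n → Bool, flipWeight (β + (1 - β) * p) x * F x := by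
  have key : ∀ x : Fin n → Bool, flipWeight (β + (1 - β) * p) x =
      ∑ y : Fin n → Bool, ∑ z : Fin n → Bool,
        flipWeight β y * flipWeight p z * if x = (fun i => y i || z i) then 1 else 0 := by
    intro x
    have h : ∀ y z : Fin n → Bool,
        flipWeight β y * flipWeight p z * (if x = (fun i => y i || z i) then 1 else 0) =
        ∏ i, (if y i then β else 1 - β) * (if z i then p else 1 - p) *
          (if x i = (y i || z i) then 1 else 0) := by
      intro y z
      rw [Finset.prod_mul_distrib, Finset.prod_mul_distrib, Finset.prod_ite_zero, flipWeight,
        flipWeight]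
      simp [funext_iff]
    simp_rw [h]
    have h2 : ∀ y : Fin n → Bool, ∑ z : Fin n → Bool,
        ∏ i, (if y i then β else 1 - β) * (if z i then p else 1 - p) *
          (if x i = (y i || z i) then (1 : ℝ) else 0) =
        ∏ i, ∑ b : Bool, (if y i then β else 1 - β) * (if b then p else 1 - p) *
          (if x i = (y i || b) then (1 : ℝ) else 0) := fun y =>
      sum_pi_prod_eq_prod_sum fun i b => (if y i then β else 1 - β) * (if b then p else 1 - p) *
          (if x i = (y i || b) then (1 : ℝ) else 0)
    simp_rw [h2]
    rw [sum_pi_prod_eq_prod_sum fun i a => ∑ b : Bool, (if a = true then β else 1 - β) *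
      (if b then p else 1 - p) * (if x i = (a || b) then (1 : ℝ) else 0)]
    refine Finset.prod_congr rfl fun i _ => ?_
    cases x i <;> simp <;> ring
  simp_rw [key, Finset.sum_mul, Finset.mul_sum]
  rw [Finset.sum_comm]
  symm
  rw [Finset.sum_comm]
  rw [Finset.sum_comm (s := (Finset.univ : Finset (Fin n → Bool)))
    (t := (Finset.univ : Finset (Fin n → Bool)))
    (f := fun z y => flipWeight β y * (flipWeight p z * F fun i => y i || z i))]
  refine Finset.sum_congr rfl fun y _ => ?_
  rw [Finset.sum_comm]
  refine Finset.sum_congr rfl fun z _ => ?_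
  simp [mul_assoc]

lemma bscLlrProb_eq_sum (γ : ℝ) {n : ℕ} (C : Set (Fin n → ℝ)) :
    bscLlrProb γ C = ∑ y : Fin n → Bool, flipWeight γ y *
      C.indicator (fun _ => (1 : ℝ)) (Real.log ((1 - γ) / γ) • flipSign y) := by
  refine Finset.sum_congr rfl fun y _ => ?_
  rw [flipWeight]
  congr 2
  funext i
  simp only [flipSign, Pi.smul_apply, smul_eq_mul]
  split_ifs <;> ring

lemma bscLlrProb_le_one {γ : ℝ} (h0 : 0 < γ) (h1 : γ < 1) {n : ℕ} (C : Set (Fin n → ℝ)) :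
    bscLlrProb γ C ≤ 1 := by
  rw [bscLlrProb_eq_sum]
  refine (Finset.sum_le_sum fun y _ => ?_).trans_eq (sum_flipWeight γ n)
  exact mul_le_of_le_one_right (flipWeight_pos h0 h1 y).le
    (Set.indicator_le_self' (fun _ _ => zero_le_one) _)

lemma log_one_sub_div_pos {γ : ℝ} (h0 : 0 < γ) (h1 : γ < 1 / 2) :
    0 < Real.log ((1 - γ) / γ) :=
  Real.log_pos ((one_lt_div h0).2 (by linarith))

section Cone

variable {n : ℕ} {C : Set (Fin n → ℝ)}

lemma smul_mem_cone_iff (hC_smul : ∀ v ∈ C, ∀ lam : ℝ, 0 < lam → lam • v ∈ C)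
    {L : ℝ} (hL : 0 < L) (v : Fin n → ℝ) : L • v ∈ C ↔ v ∈ C := by
  refine ⟨fun h => ?_, fun h => hC_smul v h L hL⟩
  simpa [smul_smul, hL.ne'] using hC_smul _ h L⁻¹ (inv_pos.2 hL)

/-- If raising each bit with probability `p` keeps the sign vector of `y` in the cone `C` with
probability at least `1 - p / 2`, then the sign vector of `y` lies in `C` with excess `p / 2`. -/
lemma flipSign_sub_mem_of_le_prob (hC_add : ∀ u ∈ C, ∀ v ∈ C, u + v ∈ C)
    (hC_smul : ∀ v ∈ C, ∀ lam : ℝ, 0 < lam → lam • v ∈ C)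
    (hC_mono : ∀ l ∈ C, ∀ u : Fin n → ℝ, (∀ i, 0 ≤ u i) → l + u ∈ C)
    {p : ℝ} (hp0 : 0 < p) (hp1 : p < 1) (y : Fin n → Bool)
    (h : 1 - p / 2 ≤ ∑ z : Fin n → Bool, flipWeight p z *
      C.indicator (fun _ => (1 : ℝ)) (flipSign fun i => y i || z i)) :
    flipSign y - (p / 2) • (1 : Fin n → ℝ) ∈ C := by
  classical
  set S : Finset (Fin n → Bool) :=
    Finset.univ.filter fun z => flipSign (fun i => y i || z i) ∈ C with hS
  have hW : ∑ z : Fin n → Bool, flipWeight p z *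
      C.indicator (fun _ => (1 : ℝ)) (flipSign fun i => y i || z i) =
      ∑ z ∈ S, flipWeight p z := by
    simp [hS, Finset.sum_filter, Set.indicator_apply]
  rw [hW] at h
  set W := ∑ z ∈ S, flipWeight p z with hWdef
  have hWpos : 0 < W := by linarith
  have hSne : S.Nonempty := by
    by_contra hne
    rw [Finset.not_nonempty_iff_eq_empty] at hne
    simp [hWdef, hne] at hWpos
  have hV : ∑ z ∈ S, flipWeight p z • flipSign (fun i => y i || z i) ∈ C := by
    refine Finset.sum_induction_nonempty _ (· ∈ C) (fun u v hu hv => hC_add u hu v hv) hSne ?_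
    intro z hz
    exact hC_smul _ (Finset.mem_filter.1 hz).2 _ (flipWeight_pos hp0 hp1 z)
  set V := ∑ z ∈ S, flipWeight p z • flipSign (fun i => y i || z i) with hVdef
  have hsV := hC_smul V hV ((1 + p / 2) / W) (by positivity)
  have hmem := hC_mono _ hsV
    (flipSign y - (p / 2) • (1 : Fin n → ℝ) - ((1 + p / 2) / W) • V) ?_
  · simpa using hmem
  intro i
  have hVi : V i = ∑ z ∈ S, flipWeight p z * (if y i || z i then -1 else 1) := by
    simp [hVdef, Finset.sum_apply, flipSign]
  simp only [Pi.sub_apply, Pi.smul_apply, Pi.one_apply, smul_eq_mul, mul_one, sub_nonneg]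
  rw [div_mul_eq_mul_div, div_le_iff₀ hWpos]
  cases hy : y i with
  | true =>
    have : V i = -W := by simp [hVi, hy, hWdef]
    rw [this]
    simp only [flipSign, hy, if_true]
    linarith
  | false =>
    have h1 : V i = W - 2 * ∑ z ∈ S, flipWeight p z * (if z i then 1 else 0) := by
      rw [hVi, hWdef, Finset.mul_sum, ← Finset.sum_sub_distrib]
      refine Finset.sum_congr rfl fun z _ => ?_
      cases hz : z i
      · simp [hy]
      · simp [hy]
        ring
    have h2 : p - (1 - W) ≤ ∑ z ∈ S, flipWeight p z * (if z i then 1 else 0) := by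
      have e1 := Finset.sum_add_sum_compl S (flipWeight p)
      have e2 := Finset.sum_add_sum_compl S
        fun z => flipWeight p z * (if z i then (1 : ℝ) else 0)
      rw [sum_flipWeight] at e1
      rw [sum_flipWeight_marginal] at e2
      have e3 : ∑ z ∈ Sᶜ, flipWeight p z * (if z i then (1 : ℝ) else 0) ≤
          ∑ z ∈ Sᶜ, flipWeight p z := by
        refine Finset.sum_le_sum fun z _ =>
          mul_le_of_le_one_right (flipWeight_pos hp0 hp1 z).le ?_
        split_ifs <;> norm_num
      linarith
    have h3 : V i ≤ 2 - 2 * p - W := by linarith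
    simp only [flipSign, hy, Bool.false_eq_true, if_false]
    have h4 : (1 + p / 2) * V i ≤ (1 + p / 2) * (2 - 2 * p - W) :=
      mul_le_mul_of_nonneg_left h3 (by linarith)
    nlinarith [sq_nonneg p]

/-- Quantitative form of the LP excess bound: the failure probability with excess is at most
`2 / p` times the failure probability on the degraded channel. -/
lemma one_sub_le_bscLlrProb_image_add (hC_add : ∀ u ∈ C, ∀ v ∈ C, u + v ∈ C)
    (hC_smul : ∀ v ∈ C, ∀ lam : ℝ, 0 < lam → lam • v ∈ C)
    (hC_mono : ∀ l ∈ C, ∀ u : Fin n → ℝ, (∀ i, 0 ≤ u i) → l + u ∈ C)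
    {β p : ℝ} (hβ0 : 0 < β) (hβ : β < 1 / 2) (hp0 : 0 < p) (hp1 : p < 1)
    (hβp : β + (1 - β) * p < 1 / 2) :
    1 - 2 / p * (1 - bscLlrProb (β + (1 - β) * p) C) ≤
      bscLlrProb β ((fun v => v + (Real.log ((1 - β) / β) * (p / 2)) • (1 : Fin n → ℝ)) '' C) := by
  classical
  have hL := log_one_sub_div_pos hβ0 hβ
  have hL' := log_one_sub_div_pos (γ := β + (1 - β) * p)
    (add_pos hβ0 (mul_pos (by linarith) hp0)) hβp
  set L := Real.log ((1 - β) / β)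
  have hscale : ∀ x : Fin n → Bool,
      C.indicator (fun _ => (1 : ℝ))
        (Real.log ((1 - (β + (1 - β) * p)) / (β + (1 - β) * p)) • flipSign x) =
      C.indicator (fun _ => (1 : ℝ)) (flipSign x) := fun x => by
    simp only [Set.indicator_apply, smul_mem_cone_iff hC_smul hL']
  rw [bscLlrProb_eq_sum (β + (1 - β) * p)]
  simp_rw [hscale]
  rw [← sum_flipWeight_or β p fun x => C.indicator (fun _ => (1 : ℝ)) (flipSign x),
    bscLlrProb_eq_sum β]
  set g : (Fin n → Bool) → ℝ := fun y => ∑ z : Fin n → Bool, flipWeight p z *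
      C.indicator (fun _ => (1 : ℝ)) (flipSign fun i => y i || z i)
  have hg1 : ∀ y, g y ≤ 1 := fun y => by
    rw [← sum_flipWeight p n]
    exact Finset.sum_le_sum fun z _ => mul_le_of_le_one_right (flipWeight_pos hp0 hp1 z).le
      (Set.indicator_le_self' (fun _ _ => zero_le_one) _)
  have hlhs : 1 - 2 / p * (1 - ∑ y, flipWeight β y * g y) =
      ∑ y, flipWeight β y * (1 - 2 / p * (1 - g y)) := by
    have : ∀ y, flipWeight β y * (1 - 2 / p * (1 - g y)) =
        flipWeight β y - 2 / p * (flipWeight β y - flipWeight β y * g y) := fun y => by ring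
    simp_rw [this, Finset.sum_sub_distrib, ← Finset.mul_sum, Finset.sum_sub_distrib,
      sum_flipWeight]
  rw [hlhs]
  refine Finset.sum_le_sum fun y _ =>
    mul_le_mul_of_nonneg_left ?_ (flipWeight_pos hβ0 (by linarith) y).le
  by_cases hgy : 1 - p / 2 ≤ g y
  · have hmem := hC_smul _
      (flipSign_sub_mem_of_le_prob hC_add hC_smul hC_mono hp0 hp1 y hgy) L hL
    rw [Set.indicator_of_mem]
    · have : 0 ≤ 2 / p * (1 - g y) := mul_nonneg (by positivity) (by linarith [hg1 y])
      linarith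
    · refine ⟨_, hmem, ?_⟩
      simp [smul_sub, smul_smul, L]
  · have h0 : 1 - 2 / p * (1 - g y) ≤ 0 := by
      have : 2 / p * (p / 2) ≤ 2 / p * (1 - g y) :=
        mul_le_mul_of_nonneg_left (by linarith) (by positivity)
      have e : 2 / p * (p / 2) = 1 := by field_simp
      linarith
    exact h0.trans (Set.indicator_nonneg (fun _ _ => zero_le_one) _)

end Cone

/-- **BSC LP Excess Lemma.**  Let `0 < β < 1/2` and let `C n ⊆ ℝ^n` be convex cones with
`C n + (ℝ≥0)^n ⊆ C n`.  If there exists `β' ∈ (β, 1/2)` with `μ_{β'}^n(C n) → 1`, then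
there exists `ε > 0` with `μ_β^n(C n + ε𝟙) → 1`. -/
theorem bsc_lp_excess
    (β : ℝ) (hβ0 : 0 < β) (hβ : β < 1 / 2)
    (C : ∀ n : ℕ, Set (Fin n → ℝ))
    (hC_add : ∀ n, ∀ u ∈ C n, ∀ v ∈ C n, u + v ∈ C n)
    (hC_smul : ∀ n, ∀ v ∈ C n, ∀ lam : ℝ, 0 < lam → lam • v ∈ C n)
    (hC_mono : ∀ n, ∀ l ∈ C n, ∀ u : Fin n → ℝ, (∀ i, 0 ≤ u i) → l + u ∈ C n)
    (hβ' : ∃ β' : ℝ, β < β' ∧ β' < 1 / 2 ∧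
      Tendsto (fun n => bscLlrProb β' (C n)) atTop (nhds 1)) :
    ∃ ε > (0 : ℝ),
      Tendsto (fun n => bscLlrProb β ((fun v => v + ε • (1 : Fin n → ℝ)) '' C n))
        atTop (nhds 1) := by
  obtain ⟨β', hlt, hβ'2, hlim⟩ := hβ'
  obtain ⟨p, hp0, hp1, rfl⟩ : ∃ p : ℝ, 0 < p ∧ p < 1 ∧ β' = β + (1 - β) * p := by
    refine ⟨(β' - β) / (1 - β), div_pos (by linarith) (by linarith), ?_, ?_⟩
    · rw [div_lt_one (by linarith)]
      linarith
    · have : 1 - β ≠ 0 := by linarith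
      field_simp
      ring
  refine ⟨Real.log ((1 - β) / β) * (p / 2),
    mul_pos (log_one_sub_div_pos hβ0 hβ) (by linarith), ?_⟩
  have hlow : Tendsto (fun n => 1 - 2 / p * (1 - bscLlrProb (β + (1 - β) * p) (C n)))
      atTop (nhds 1) := by
    simpa using ((hlim.const_sub 1).const_mul (2 / p)).const_sub 1
  refine tendsto_of_tendsto_of_tendsto_of_le_of_le hlow tendsto_const_nhds (fun n => ?_)
    fun n => bscLlrProb_le_one hβ0 (by linarith) _
  exact one_sub_le_bscLlrProb_image_add (hC_add n) (hC_smul n) (hC_mono n) hβ0 hβ hp0 hp1 hβ'2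
end

section
/- AWGN LP excess lemma. Let n ≥ 1 and let C ⊆ ℝ^n be a Borel set closed under multiplication by positive scalars (λ·v ∈ C for all v ∈ C, λ > 0). Let 0 < σ < σ' and ε = (σ' − σ)/σ'. Let Z = (Z_1, …, Z_n) be i.i.d. standard Gaussian N(0,1) random variables. Then Pr[𝟙 + σ'·Z ∈ C] = Pr[𝟙 + σ·Z ∈ C + ε𝟙], where 𝟙 ∈ ℝ^n is the all-ones vector. Interpreting C as the fundamental cone of a P-LP decoder of a binary linear code (which is closed under positive scaling, and noting that on the σ-AWGN the LLR vector given the all-zeros codeword is the positive scalar multiple (2/σ²)(𝟙 + σZ) of the received vector), this says: the probability of success of the P-LP decoder on the σ'-AWGN channel equals its probability of success on the σ-AWGN channel with excess ε in the received-vector normalization. -/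
open MeasureTheory ProbabilityTheory

/-- **AWGN LP excess lemma.**  Let `C ⊆ ℝ^n` be a Borel set closed under multiplication by
positive scalars (e.g. the fundamental cone of a `P`-LP decoder), `0 < σ < σ'` and
`ε = (σ' − σ)/σ'`.  With `Z = (Z_1, …, Z_n)` i.i.d. standard Gaussians,
`Pr[𝟙 + σ'·Z ∈ C] = Pr[𝟙 + σ·Z ∈ C + ε𝟙]`: the probability of LP decoding success on the
`σ'`-AWGN equals the probability of success on the `σ`-AWGN with excess `ε` in the
received-vector normalization. -/
theorem awgn_lp_excess (n : ℕ) (hn : 1 ≤ n)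
    (C : Set (Fin n → ℝ)) (hC_meas : MeasurableSet C)
    (hC_smul : ∀ v ∈ C, ∀ lam : ℝ, 0 < lam → lam • v ∈ C)
    (σ σ' : ℝ) (hσ : 0 < σ) (hσσ' : σ < σ')
    (ε : ℝ) (hε : ε = (σ' - σ) / σ') :
    (Measure.pi fun _ : Fin n => gaussianReal 0 1)
        {z : Fin n → ℝ | (fun i => 1 + σ' * z i) ∈ C} =
      (Measure.pi fun _ : Fin n => gaussianReal 0 1)
        {z : Fin n → ℝ | (fun i => 1 + σ * z i) ∈
          (fun v => v + ε • (1 : Fin n → ℝ)) '' C} := by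
  have hσ' : 0 < σ' := hσ.trans hσσ'
  have key (z : Fin n → ℝ) : (fun i => 1 + σ * z i) - ε • (1 : Fin n → ℝ) =
      (σ / σ') • fun i => 1 + σ' * z i := by
    ext i
    simp only [hε, Pi.sub_apply, Pi.smul_apply, Pi.one_apply, smul_eq_mul]
    field_simp
    ring
  congr 1
  ext z
  constructor
  · intro hz
    refine ⟨(fun i => 1 + σ * z i) - ε • (1 : Fin n → ℝ), ?_, sub_add_cancel _ _⟩
    rw [key]
    exact hC_smul _ hz _ (div_pos hσ hσ')
  · rintro ⟨v, hv, hvz⟩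
    have hv_eq : v = (σ / σ') • fun i => 1 + σ' * z i := by
      rw [← key, ← hvz]
      exact (add_sub_cancel_right _ _).symm
    have hmem := hC_smul v hv (σ' / σ) (div_pos hσ' hσ)
    rwa [hv_eq, smul_smul, div_mul_div_cancel₀ hσ.ne', div_self hσ'.ne', one_smul] at hmem
end

section
/- Bounded-weight redundant checks suffice on discrete MSB channels. Let G = {G_n}_n be an infinite family of Tanner graphs, where G_n has n variable nodes and maximum check degree at most a constant d, and assume G is asymptotically strong. Let ch = (Σ, p, *) be a discrete MSB channel with LLR distribution μ given input 0, and assume there exists α > 0 such that for every α-distortion ch' of ch, with LLR distribution μ', one has lim_{n→∞} Pr_{l ~ μ'^n}[the P(Ḡ_n)-LP decoder succeeds on l] = 1, where Ḡ_n has as checks all nonzero dual codewords of C(G_n). Then there exists a constant k ≥ d, depending only on α and the channel ch (and not on n), such that lim_{n→∞} Pr_{l ~ μ^n}[the P(Ḡ_n^k)-LP decoder succeeds on l] = 1, where Ḡ_n^k has as checks all nonzero dual codewords of C(G_n) of Hamming weight at most k. -/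
open Finset Filter

/-- The binary linear code of a Tanner graph with check set `H ⊆ F₂^n`. -/
def tannerCode {n : ℕ} (H : Set (Fin n → ZMod 2)) : Set (Fin n → ZMod 2) :=
  {x | ∀ h ∈ H, ∑ i, h i * x i = 0}

/-- Embedding of a binary vector into `ℝ^n`. -/
noncomputable def toRealVec {n : ℕ} (x : Fin n → ZMod 2) : Fin n → ℝ :=
  fun i => ((x i).val : ℝ)

/-- The Feldman LP polytope of a Tanner graph with check set `H`: the intersection, over
checks `h`, of the convex hulls of the binary vectors satisfying check `h`. -/
def feldmanPolytope {n : ℕ} (H : Set (Fin n → ZMod 2)) : Set (Fin n → ℝ) :=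
  ⋂ h ∈ H, convexHull ℝ
    {ξ | ∃ x : Fin n → ZMod 2, ξ = toRealVec x ∧ ∑ i, h i * x i = 0}

/-- The checks of `Ḡ`: all nonzero dual codewords of the code of `H`. -/
def allDualChecks {n : ℕ} (H : Set (Fin n → ZMod 2)) : Set (Fin n → ZMod 2) :=
  {h | h ≠ 0 ∧ ∀ x ∈ tannerCode H, ∑ i, h i * x i = 0}

/-- The checks of `Ḡ^k`: all nonzero dual codewords of Hamming weight at most `k`. -/
def dualChecksLe {n : ℕ} (H : Set (Fin n → ZMod 2)) (k : ℕ) : Set (Fin n → ZMod 2) :=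
  {h | h ∈ allDualChecks H ∧ hammingNorm h ≤ k}

/-- A family of Tanner graphs is asymptotically strong if for every `ε ∈ (0,1]` there is a
`δ > 0` such that for all sufficiently large `n` and every `U ⊆ {1,…,n}` with `|U| ≤ δn`,
the LP decoder of `G n` succeeds on the vector equal to `-1` on `U` and `ε` elsewhere. -/
def AsympStrong (G : ∀ n : ℕ, Set (Fin n → ZMod 2)) : Prop :=
  ∀ ε : ℝ, 0 < ε → ε ≤ 1 → ∃ δ : ℝ, 0 < δ ∧ ∃ N : ℕ, ∀ n ≥ N,
    ∀ U : Finset (Fin n), (U.card : ℝ) ≤ δ * n →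
      LPsucceeds (feldmanPolytope (G n)) (fun i => if i ∈ U then -1 else ε)

/-- A family of Tanner graphs of maximum check degree `d` is rigid if for every constant
`k ≥ d`, the polytope of `Ḡ_n^k` equals the polytope of `G_n` for all large enough `n`. -/
def Rigid (d : ℕ) (G : ∀ n : ℕ, Set (Fin n → ZMod 2)) : Prop :=
  ∀ k ≥ d, ∃ N : ℕ, ∀ n ≥ N,
    feldmanPolytope (dualChecksLe (G n) k) = feldmanPolytope (G n)

/-- A binary vector is annihilated by every codeword of the code of `H`. -/
def IsDual {n : ℕ} (H : Set (Fin n → ZMod 2)) (h : Fin n → ZMod 2) : Prop :=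
  ∀ x ∈ tannerCode H, ∑ i, h i * x i = 0

section LocalPolytope

variable {n : ℕ}

lemma IsDual.zero (H : Set (Fin n → ZMod 2)) : IsDual H 0 := by
  intro x _; simp

lemma IsDual.add {H : Set (Fin n → ZMod 2)} {g h : Fin n → ZMod 2}
    (hg : IsDual H g) (hh : IsDual H h) : IsDual H (g + h) := by
  intro x hx
  simp [add_mul, Finset.sum_add_distrib, hg x hx, hh x hx]

lemma IsDual.sum {H : Set (Fin n → ZMod 2)} {ι : Type*} (s : Finset ι)
    (g : ι → Fin n → ZMod 2) (hg : ∀ i ∈ s, IsDual H (g i)) : IsDual H (∑ i ∈ s, g i) :=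
  Finset.sum_induction g (IsDual H) (fun _ _ => IsDual.add) (IsDual.zero H) hg

/-- The nonzero residue modulo two is one. -/
lemma zmod_two_eq_one {a : ZMod 2} (ha : a ≠ 0) : a = 1 := by
  revert ha; revert a; decide

lemma toRealVec_nonneg (x : Fin n → ZMod 2) (i : Fin n) : 0 ≤ toRealVec x i :=
  Nat.cast_nonneg _

lemma toRealVec_le_one (x : Fin n → ZMod 2) (i : Fin n) : toRealVec x i ≤ 1 := by
  have := ZMod.val_lt (x i)
  unfold toRealVec
  exact_mod_cast Nat.lt_succ_iff.mp this

lemma toRealVec_add_le (x y : Fin n → ZMod 2) (i : Fin n) :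
    toRealVec (x + y) i ≤ toRealVec x i + toRealVec y i := by
  unfold toRealVec
  exact_mod_cast ZMod.val_add_le (x i) (y i)

lemma toRealVec_zero : toRealVec (0 : Fin n → ZMod 2) = 0 := by
  ext i; simp [toRealVec]

lemma toRealVec_single (i : Fin n) :
    toRealVec (Pi.single i 1 : Fin n → ZMod 2) = Pi.single i 1 := by
  ext j
  by_cases h : j = i
  · subst h; simp [toRealVec, ZMod.val_one]
  · simp [toRealVec, h]

lemma toRealVec_eq_ite (x : Fin n → ZMod 2) (i : Fin n) :
    toRealVec x i = if x i ≠ 0 then 1 else 0 := by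
  by_cases h : x i = 0
  · simp [toRealVec, h]
  · simp [toRealVec, zmod_two_eq_one h, ZMod.val_one]

/-- The support of a check. -/
def checkSupp (h : Fin n → ZMod 2) : Finset (Fin n) := univ.filter fun i => h i ≠ 0

lemma mem_checkSupp {h : Fin n → ZMod 2} {i : Fin n} : i ∈ checkSupp h ↔ h i ≠ 0 := by
  simp [checkSupp]

/-- Points of a local polytope lie in the unit cube and satisfy the cone inequalities. -/
lemma local_polytope_inequalities {h : Fin n → ZMod 2} {x : Fin n → ℝ}
    (hx : x ∈ convexHull ℝ
      {ξ | ∃ x : Fin n → ZMod 2, ξ = toRealVec x ∧ ∑ i, h i * x i = 0}) :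
    (∀ i, 0 ≤ x i) ∧ (∀ i, x i ≤ 1) ∧
      ∀ i ∈ checkSupp h, x i ≤ ∑ j ∈ (checkSupp h).erase i, x j := by
  have hconv : Convex ℝ {x : Fin n → ℝ | (∀ i, 0 ≤ x i) ∧ (∀ i, x i ≤ 1) ∧
      ∀ i ∈ checkSupp h, x i ≤ ∑ j ∈ (checkSupp h).erase i, x j} := by
    intro x hx y hy a b ha hb hab
    refine ⟨fun i => ?_, fun i => ?_, fun i hi => ?_⟩
    · have := hx.1 i; have := hy.1 i
      simp only [Pi.add_apply, Pi.smul_apply, smul_eq_mul]; positivity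
    · have h1 := hx.2.1 i; have h2 := hy.2.1 i
      simp only [Pi.add_apply, Pi.smul_apply, smul_eq_mul]; nlinarith
    · have h1 := hx.2.2 i hi; have h2 := hy.2.2 i hi
      simp only [Pi.add_apply, Pi.smul_apply, smul_eq_mul, Finset.sum_add_distrib,
        ← Finset.mul_sum]
      gcongr
  refine convexHull_min ?_ hconv hx
  rintro _ ⟨c, rfl, hc⟩
  refine ⟨toRealVec_nonneg c, toRealVec_le_one c, fun i hi => ?_⟩
  by_cases hci : c i = 0
  · rw [toRealVec_eq_ite]
    simpa [hci] using Finset.sum_nonneg fun j _ => toRealVec_nonneg c j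
  · have : ∃ j ∈ (checkSupp h).erase i, c j ≠ 0 := by
      by_contra! hcon
      have hsum : ∑ j, h j * c j = h i * c i := by
        refine Finset.sum_eq_single i (fun j _ hji => ?_) (by simp)
        by_cases hj : h j = 0
        · simp [hj]
        · simp [hcon j (by simp [mem_checkSupp, hj, hji])]
      rw [hsum] at hc
      exact mul_ne_zero (mem_checkSupp.mp hi) hci hc
    obtain ⟨j, hj, hcj⟩ := this
    calc toRealVec c i ≤ 1 := toRealVec_le_one c i
      _ = toRealVec c j := by rw [toRealVec_eq_ite]; simp [hcj]
      _ ≤ _ := Finset.single_le_sum (fun j _ => toRealVec_nonneg c j) hj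

/-- Small nonnegative vectors satisfying the cone inequalities lie in the local polytope. -/
lemma mem_local_polytope {h : Fin n → ZMod 2} {y : Fin n → ℝ}
    (h0 : ∀ i, 0 ≤ y i) (h1 : ∑ i, y i ≤ 1)
    (hcone : ∀ i ∈ checkSupp h, y i ≤ ∑ j ∈ (checkSupp h).erase i, y j) :
    y ∈ convexHull ℝ
      {ξ | ∃ x : Fin n → ZMod 2, ξ = toRealVec x ∧ ∑ i, h i * x i = 0} := by
  set E : Set (Fin n → ℝ) :=
    {ξ | ∃ x : Fin n → ZMod 2, ξ = toRealVec x ∧ ∑ i, h i * x i = 0} with hE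
  have hfin : E.Finite := by
    refine (Set.finite_range (toRealVec (n := n))).subset ?_
    rintro _ ⟨x, rfl, _⟩
    exact ⟨x, rfl⟩
  by_contra hy
  obtain ⟨f, u, hfu, huf⟩ := geometric_hahn_banach_closed_point (convex_convexHull ℝ E)
    (hfin.isClosed_convexHull ℝ) hy
  have hfE : ∀ x : Fin n → ZMod 2, ∑ i, h i * x i = 0 → f (toRealVec x) < u :=
    fun x hx => hfu _ (subset_convexHull ℝ E ⟨x, rfl, hx⟩)
  set F : Fin n → ℝ := fun i => f (Pi.single i 1) with hF
  have hu : 0 < u := by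
    have := hfE 0 (by simp)
    simpa [toRealVec_zero] using this
  have hout : ∀ i, i ∉ checkSupp h → F i < u := by
    intro i hi
    have := hfE (Pi.single i 1) (by
      simpa [Pi.single_apply, mem_checkSupp] using hi)
    rwa [toRealVec_single] at this
  have hpair : ∀ i ∈ checkSupp h, ∀ j ∈ checkSupp h, i ≠ j → F i + F j < u := by
    intro i hi j hj hij
    have hval : toRealVec (Pi.single i 1 + Pi.single j 1 : Fin n → ZMod 2)
        = Pi.single i 1 + Pi.single j 1 := by
      ext t
      by_cases hti : t = i
      · subst hti; simp [toRealVec, hij, ZMod.val_one]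
      · by_cases htj : t = j
        · subst htj; simp [toRealVec, hti, ZMod.val_one]
        · simp [toRealVec, hti, htj]
    have := hfE (Pi.single i 1 + Pi.single j 1) (by
      simp only [Pi.add_apply, mul_add, Finset.sum_add_distrib]
      have h1 := zmod_two_eq_one (mem_checkSupp.mp hi)
      have h2 := zmod_two_eq_one (mem_checkSupp.mp hj)
      simp [Pi.single_apply, h1, h2]
      decide)
    rw [hval, map_add] at this
    exact this
  have hfy : f y = ∑ i, y i * F i := by
    conv_lhs => rw [pi_eq_sum_univ' y]
    simp [hF, map_sum, Pi.single]
  rw [hfy] at huf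
  refine absurd huf (not_lt.mpr ?_)
  by_cases hbig : ∃ a ∈ checkSupp h, u < F a
  · obtain ⟨a, ha, hFa⟩ := hbig
    have hco := hcone a ha
    set O := ∑ j ∈ (checkSupp h).erase a, y j with hO
    have hsub : (checkSupp h) ⊆ univ := subset_univ _
    have e1 : ∀ g : Fin n → ℝ, ∑ i, g i = (∑ i ∈ univ \ checkSupp h, g i)
        + (g a + ∑ j ∈ (checkSupp h).erase a, g j) := by
      intro g
      rw [Finset.add_sum_erase _ _ ha, Finset.sum_sdiff hsub]
    have b1 : ∑ i ∈ univ \ checkSupp h, y i * F i ≤ ∑ i ∈ univ \ checkSupp h, y i * u :=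
      Finset.sum_le_sum fun i hi =>
        mul_le_mul_of_nonneg_left (hout i (by simpa using hi)).le (h0 i)
    have b2 : ∑ j ∈ (checkSupp h).erase a, y j * F j
        ≤ ∑ j ∈ (checkSupp h).erase a, y j * (u - F a) :=
      Finset.sum_le_sum fun j hj => mul_le_mul_of_nonneg_left
        (by linarith [hpair a ha j (Finset.mem_of_mem_erase hj)
              (Finset.ne_of_mem_erase hj).symm]) (h0 j)
    rw [← Finset.sum_mul] at b1 b2
    rw [e1] at h1
    rw [e1]
    have := h0 a
    have hO0 : 0 ≤ O := Finset.sum_nonneg fun j _ => h0 j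
    nlinarith [mul_nonneg (sub_nonneg.mpr hco) (sub_nonneg.mpr hFa.le)]
  · push Not at hbig
    calc ∑ i, y i * F i ≤ ∑ i, y i * u := by
          refine Finset.sum_le_sum fun i _ => mul_le_mul_of_nonneg_left ?_ (h0 i)
          by_cases hi : i ∈ checkSupp h
          · exact hbig i hi
          · exact (hout i hi).le
      _ = (∑ i, y i) * u := by rw [Finset.sum_mul]
      _ ≤ u := by nlinarith

end LocalPolytope

section RedundantChecks

variable {n : ℕ}

/-- The cost of a binary vector is subadditive. -/
lemma cost_sum_le (z : Fin n → ℝ) (hz : ∀ i, 0 ≤ z i) {ι : Type*} (s : Finset ι)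
    (w : ι → Fin n → ZMod 2) :
    ∑ i, z i * toRealVec (∑ j ∈ s, w j) i ≤ ∑ j ∈ s, ∑ i, z i * toRealVec (w j) i := by
  refine Finset.le_sum_of_subadditive (fun c : Fin n → ZMod 2 => ∑ i, z i * toRealVec c i)
    (by simp [toRealVec_zero]) (fun c e => ?_) s w
  rw [← Finset.sum_add_distrib]
  refine Finset.sum_le_sum fun i _ => ?_
  rw [← mul_add]
  exact mul_le_mul_of_nonneg_left (toRealVec_add_le c e i) (hz i)

/-- Capped coset weights satisfy all cone inequalities: given costs `z` and a set `N` of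
forbidden positions, the least cost `y i` of expressing position `i` through allowed
positions modulo the dual code satisfies every dual check. -/
lemma exists_capped_coset_weight (H : Set (Fin n → ZMod 2)) (N : Finset (Fin n))
    (z : Fin n → ℝ) (hz : ∀ i, 0 ≤ z i) :
    ∃ y : Fin n → ℝ, (∀ i, 0 ≤ y i) ∧ (∀ i, y i ≤ 1) ∧ (∀ i ∉ N, y i ≤ z i) ∧
      (∀ i, y i = 1 ∨ ∃ w : Fin n → ZMod 2, (∀ j ∈ N, w j = 0) ∧
        IsDual H (w + Pi.single i 1) ∧ y i = ∑ j, z j * toRealVec w j) ∧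
      (∀ h, IsDual H h → ∀ i ∈ checkSupp h, y i ≤ ∑ j ∈ (checkSupp h).erase i, y j) := by
  classical
  have hmin : ∀ i, ∃ m : ℝ, (m = 1 ∨ ∃ w : Fin n → ZMod 2, (∀ j ∈ N, w j = 0) ∧
        IsDual H (w + Pi.single i 1) ∧ m = ∑ j, z j * toRealVec w j) ∧ m ≤ 1 ∧
        ∀ w : Fin n → ZMod 2, (∀ j ∈ N, w j = 0) → IsDual H (w + Pi.single i 1) →
          m ≤ ∑ j, z j * toRealVec w j := by
    intro i
    let C : Finset ℝ := insert 1 (Finset.image (fun w => ∑ j, z j * toRealVec w j)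
      (univ.filter fun w : Fin n → ZMod 2 => (∀ j ∈ N, w j = 0) ∧ IsDual H (w + Pi.single i 1)))
    obtain ⟨m, hm, hle⟩ := Finset.exists_min_image C id ⟨1, Finset.mem_insert_self _ _⟩
    refine ⟨m, ?_, hle 1 (Finset.mem_insert_self _ _), fun w h1 h2 => hle _ ?_⟩
    · rcases Finset.mem_insert.mp hm with h | h
      · exact Or.inl h
      · obtain ⟨w, hw, rfl⟩ := Finset.mem_image.mp h
        obtain ⟨h1, h2⟩ := (Finset.mem_filter.mp hw).2
        exact Or.inr ⟨w, h1, h2, rfl⟩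
    · exact Finset.mem_insert_of_mem (Finset.mem_image.mpr
        ⟨w, Finset.mem_filter.mpr ⟨Finset.mem_univ _, h1, h2⟩, rfl⟩)
  choose y hy hy1 hyw using hmin
  have hcost : ∀ w, 0 ≤ ∑ j, z j * toRealVec w j := fun w =>
    Finset.sum_nonneg fun j _ => mul_nonneg (hz j) (toRealVec_nonneg w j)
  have hy0 : ∀ i, 0 ≤ y i := by
    intro i
    rcases hy i with h | ⟨w, -, -, h⟩
    · rw [h]; exact zero_le_one
    · rw [h]; exact hcost w
  refine ⟨y, hy0, hy1, fun i hi => ?_, hy, fun h hh i hi => ?_⟩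
  · have hdual : IsDual H (Pi.single i 1 + Pi.single i 1) := by
      have : (Pi.single i 1 + Pi.single i 1 : Fin n → ZMod 2) = 0 := by
        ext j
        simp [CharTwo.add_self_eq_zero]
      rw [this]; exact IsDual.zero H
    have := hyw i (Pi.single i 1) (fun j hj => Pi.single_eq_of_ne (by rintro rfl; exact hi hj) _)
      hdual
    rw [toRealVec_single] at this
    simpa [Pi.single_apply] using this
  · by_cases hcap : ∃ j ∈ (checkSupp h).erase i, y j = 1
    · obtain ⟨j, hj, hj1⟩ := hcap
      calc y i ≤ y j := by rw [hj1]; exact hy1 i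
        _ ≤ _ := Finset.single_le_sum (fun j _ => hy0 j) hj
    · push Not at hcap
      have hex : ∀ j, ∃ w : Fin n → ZMod 2, j ∈ (checkSupp h).erase i → (∀ j ∈ N, w j = 0) ∧
          IsDual H (w + Pi.single j 1) ∧ y j = ∑ t, z t * toRealVec w t := by
        intro j
        by_cases hj : j ∈ (checkSupp h).erase i
        · rcases hy j with h1 | ⟨w, hw⟩
          · exact absurd h1 (hcap j hj)
          · exact ⟨w, fun _ => hw⟩
        · exact ⟨0, fun h => absurd h hj⟩
      choose w hw using hex
      have hsplit : h = ∑ j ∈ (checkSupp h).erase i, Pi.single j 1 + Pi.single i 1 := by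
        rw [Finset.sum_erase_add _ _ hi]
        ext t
        rw [Finset.sum_apply]
        by_cases ht : h t = 0
        · simp [Pi.single_apply, mem_checkSupp, ht]
        · simp [Pi.single_apply, mem_checkSupp, zmod_two_eq_one ht]
      have hd : IsDual H (∑ j ∈ (checkSupp h).erase i, w j + Pi.single i 1) := by
        have e : (∑ j ∈ (checkSupp h).erase i, w j + Pi.single i 1 : Fin n → ZMod 2)
            = ∑ j ∈ (checkSupp h).erase i, (w j + Pi.single j 1) + h := by
          rw [Finset.sum_add_distrib]
          ext t
          have h1 := congrFun hsplit t
          have := CharTwo.add_self_eq_zero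
            ((∑ j ∈ (checkSupp h).erase i, (Pi.single j 1 : Fin n → ZMod 2)) t)
          simp only [Pi.add_apply] at h1 ⊢
          linear_combination -this - h1
        rw [e]
        exact (IsDual.sum _ _ fun j hj => (hw j hj).2.1).add hh
      calc y i ≤ ∑ t, z t * toRealVec (∑ j ∈ (checkSupp h).erase i, w j) t := by
            refine hyw i _ (fun t ht => ?_) hd
            rw [Finset.sum_apply]
            exact Finset.sum_eq_zero fun j hj => (hw j hj).1 t ht
        _ ≤ _ := cost_sum_le z hz _ _
        _ = _ := Finset.sum_congr rfl fun j hj => ((hw j hj).2.2).symm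

lemma feldmanPolytope_anti {H K : Set (Fin n → ZMod 2)} (h : H ⊆ K) :
    feldmanPolytope K ⊆ feldmanPolytope H :=
  Set.biInter_subset_biInter_left h

lemma subset_allDualChecks {H : Set (Fin n → ZMod 2)} (hH : ∀ h ∈ H, h ≠ 0) :
    H ⊆ allDualChecks H :=
  fun h hh => ⟨hH h hh, fun _ hx => hx h hh⟩

/-- If the decoder succeeds on some vector, the polytope lies in the unit cube. -/
lemma mem_cube_of_LPsucceeds {H : Set (Fin n → ZMod 2)} {l x : Fin n → ℝ}
    (hl : LPsucceeds (feldmanPolytope H) l) (hx : x ∈ feldmanPolytope H) :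
    (∀ i, 0 ≤ x i) ∧ (∀ i, x i ≤ 1) := by
  rcases H.eq_empty_or_nonempty with rfl | ⟨h, hh⟩
  · by_cases hx0 : x = 0
    · simp [hx0]
    · have h1 := hl x hx hx0
      have h2 := hl (-x) (by simp [feldmanPolytope]) (neg_ne_zero.mpr hx0)
      simp only [Pi.neg_apply, neg_mul, Finset.sum_neg_distrib] at h2
      linarith
  · have := local_polytope_inequalities (Set.mem_iInter₂.mp hx h hh)
    exact ⟨this.1, this.2.1⟩

/-- If `v` is nonnegative on the polytope of all dual checks, it is nonnegative on every
nonnegative vector satisfying the cone inequalities of all dual checks. -/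
lemma cone_nonneg_of_polytope {H : Set (Fin n → ZMod 2)} {v y : Fin n → ℝ}
    (hv : ∀ x ∈ feldmanPolytope (allDualChecks H), 0 ≤ ∑ i, x i * v i)
    (h0 : ∀ i, 0 ≤ y i)
    (hcone : ∀ h, IsDual H h → ∀ i ∈ checkSupp h, y i ≤ ∑ j ∈ (checkSupp h).erase i, y j) :
    0 ≤ ∑ i, y i * v i := by
  set s : ℝ := 1 / (∑ i, y i + 1) with hs
  have hY : 0 ≤ ∑ i, y i := Finset.sum_nonneg fun i _ => h0 i
  have hspos : 0 < s := by positivity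
  have hmem : (fun i => s * y i) ∈ feldmanPolytope (allDualChecks H) := by
    refine Set.mem_iInter₂.mpr fun h hh => mem_local_polytope
      (fun i => mul_nonneg hspos.le (h0 i)) ?_ fun i hi => ?_
    · rw [← Finset.mul_sum, hs, div_mul_eq_mul_div, div_le_one (by positivity)]
      linarith
    · rw [← Finset.mul_sum]
      exact mul_le_mul_of_nonneg_left (hcone h hh.2 i hi) hspos.le
  have := hv _ hmem
  simp only [mul_assoc, ← Finset.mul_sum] at this
  exact nonneg_of_mul_nonneg_right this hspos

/-- Restricting to dual checks of weight at most `k` loses at most an additive margin `c`. -/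
lemma LPsucceeds_of_margin {d k : ℕ} (hdk : d ≤ k) {H : Set (Fin n → ZMod 2)}
    (hH : ∀ h ∈ H, h ≠ 0 ∧ hammingNorm h ≤ d) {ε η δ B c : ℝ}
    (hε : 0 < ε) (hη : 0 < η) (hB : 0 ≤ B) (hc : B * (ε + η) < c) (hk : 1 ≤ δ * (k * η))
    (hstrong : ∀ U : Finset (Fin n), (U.card : ℝ) ≤ δ * n →
      LPsucceeds (feldmanPolytope H) (fun i => if i ∈ U then -1 else ε))
    {l : Fin n → ℝ} (hlB : ∀ i, |l i - c| ≤ B)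
    (hl : ∀ x ∈ feldmanPolytope (allDualChecks H), 0 ≤ ∑ i, x i * (l i - c)) :
    LPsucceeds (feldmanPolytope (dualChecksLe H k)) l := by
  classical
  intro x hx hx0
  have hsub : H ⊆ dualChecksLe H k := fun h hh =>
    ⟨subset_allDualChecks (fun h hh => (hH h hh).1) hh, (hH h hh).2.trans hdk⟩
  have hxH := feldmanPolytope_anti hsub hx
  have hn : 0 < n := by
    rcases Nat.eq_zero_or_pos n with h | h
    · subst h; exact absurd (Subsingleton.elim x 0) hx0
    · exact h
  have hn' : (0 : ℝ) < n := by exact_mod_cast hn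
  have hineq : ∀ h ∈ dualChecksLe H k, _ := fun h hh =>
    local_polytope_inequalities (Set.mem_iInter₂.mp hx h hh)
  have hδ : 0 ≤ δ := by
    by_contra! hneg
    have : 0 ≤ (k : ℝ) * η := by positivity
    nlinarith
  obtain ⟨hx0', hx1⟩ := mem_cube_of_LPsucceeds (hstrong ∅ (by simpa using by positivity)) hxH
  set X := ∑ i, x i with hX
  have hXpos : 0 < X := by
    refine lt_of_le_of_ne (Finset.sum_nonneg fun i _ => hx0' i) fun h => hx0 ?_
    ext i
    exact (Finset.sum_eq_zero_iff_of_nonneg fun i _ => hx0' i).mp h.symm i (mem_univ i)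
  have hk0 : (0 : ℝ) < k := by
    rcases Nat.eq_zero_or_pos k with h | h
    · subst h; norm_num at hk
    · exact_mod_cast h
  set b : ℝ := η * (X / n) with hb
  have hbpos : 0 < b := by positivity
  set U : Finset (Fin n) := univ.filter fun i => k * b < x i with hU
  have hUcard : (U.card : ℝ) ≤ δ * n := by
    have h1 : (U.card : ℝ) * (k * b) ≤ X := by
      calc (U.card : ℝ) * (k * b) = ∑ i ∈ U, k * b := by simp
        _ ≤ ∑ i ∈ U, x i := Finset.sum_le_sum fun i hi => (Finset.mem_filter.mp hi).2.le
        _ ≤ X := Finset.sum_le_univ_sum_of_nonneg hx0'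
    have h2 : X ≤ (δ * n) * (k * b) := by
      have : (δ * n) * (k * b) = (δ * (k * η)) * X := by rw [hb]; field_simp
      rw [this]; nlinarith
    exact le_of_mul_le_mul_right (h1.trans h2) (by positivity)
  have hUsum : ∑ i, (if i ∈ U then x i else 0) ≤ ε * X := by
    have h1 := hstrong U hUcard x hxH hx0
    have h2 : ∑ i, x i * (if i ∈ U then -1 else ε)
        ≤ ∑ i, (ε * x i - if i ∈ U then x i else 0) := by
      refine Finset.sum_le_sum fun i _ => ?_
      have := mul_nonneg hε.le (hx0' i)
      split_ifs <;> linarith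
    rw [Finset.sum_sub_distrib, ← Finset.mul_sum] at h2
    linarith
  set N : Finset (Fin n) := univ.filter fun i => l i - c < 0 with hN
  obtain ⟨y, hy0, -, hyz, hyw, hycone⟩ :=
    exists_capped_coset_weight H N (fun i => x i + b) (fun i => by have := hx0' i; positivity)
  have hyx : ∀ i ∈ N, i ∉ U → x i ≤ y i := by
    intro i hiN hiU
    rcases hyw i with h | ⟨w, hwN, hwd, hyi⟩
    · rw [h]; exact hx1 i
    · have hwi : w i = 0 := hwN i hiN
      have hcost : ∑ j, (x j + b) * toRealVec w j = ∑ j ∈ checkSupp w, (x j + b) := by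
        rw [checkSupp, Finset.sum_filter]
        refine Finset.sum_congr rfl fun j _ => ?_
        rw [toRealVec_eq_ite]; split_ifs <;> simp
      have hsupp : checkSupp (w + Pi.single i 1) = insert i (checkSupp w) := by
        ext j
        by_cases hj : j = i
        · subst hj; simp [mem_checkSupp, hwi]
        · simp [mem_checkSupp, hj]
      have hiw : i ∉ checkSupp w := by simp [mem_checkSupp, hwi]
      rw [hyi, hcost]
      by_cases hwt : hammingNorm (w + Pi.single i 1) ≤ k
      · have hmem : w + Pi.single i 1 ∈ dualChecksLe H k := by
          refine ⟨⟨fun h0 => ?_, hwd⟩, hwt⟩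
          have := congrFun h0 i
          simp [hwi] at this
        have := (hineq _ hmem).2.2 i (by rw [hsupp]; exact Finset.mem_insert_self _ _)
        rw [hsupp, Finset.erase_insert hiw] at this
        refine this.trans (Finset.sum_le_sum fun j _ => by linarith)
      · have hcard : hammingNorm (w + Pi.single i 1) = (checkSupp w).card + 1 := by
          rw [← Finset.card_insert_of_notMem hiw, ← hsupp]; rfl
        have hkw : (k : ℝ) ≤ (checkSupp w).card := by
          exact_mod_cast (by omega : k ≤ (checkSupp w).card)
        have hxi : x i ≤ k * b := by simpa [hU] using hiU
        calc x i ≤ k * b := hxi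
          _ ≤ (checkSupp w).card * b := by gcongr
          _ = ∑ j ∈ checkSupp w, b := by simp
          _ ≤ _ := Finset.sum_le_sum fun j _ => by linarith [hx0' j]
  have hyv := cone_nonneg_of_polytope hl hy0 hycone
  have hterm : ∀ i, y i * (l i - c)
      ≤ x i * (l i - c) + B * (if i ∈ U then x i else 0) + B * b := by
    intro i
    have hb1 := abs_le.mp (hlB i)
    have hxi := hx0' i
    have hyi := hy0 i
    have hBb : 0 ≤ B * b := by positivity
    by_cases hiN : i ∈ N
    · have hneg : l i - c < 0 := by simpa [hN] using hiN
      by_cases hiU : i ∈ U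
      · simp only [hiU, if_true]
        nlinarith
      · simp only [hiU, if_false]
        have := hyx i hiN hiU
        nlinarith
    · have hpos : 0 ≤ l i - c := by simpa [hN] using hiN
      have h3 := hyz i hiN
      have h4 : 0 ≤ B * (if i ∈ U then x i else 0) := by split_ifs <;> positivity
      nlinarith
  have hsum := Finset.sum_le_sum fun i (_ : i ∈ univ) => hterm i
  simp only [Finset.sum_add_distrib, ← Finset.mul_sum, mul_sub, Finset.sum_sub_distrib,
    ← Finset.sum_mul] at hsum hyv
  have hnb : B * ∑ _i : Fin n, b = B * (η * X) := by
    congr 1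
    simp [hb]; field_simp
  rw [hnb] at hsum
  nlinarith [mul_le_mul_of_nonneg_left hUsum hB, mul_pos hXpos (sub_pos.mpr hc)]

end RedundantChecks

section Degradation

variable {S : Type*}

lemma LLR_involution {p : S → ℝ} {st : S → S} (hst : ∀ a, st (st a) = a) (a : S) :
    LLR p st (st a) = -LLR p st a := by
  unfold LLR
  rw [hst, ← Real.log_inv, inv_div]

/-- A bijective change of variables along the involution. -/
lemma sum_comp_involution [Fintype S] {st : S → S} (hst : ∀ a, st (st a) = a) (f : S → ℝ) :
    ∑ a, f (st a) = ∑ a, f a :=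
  Equiv.sum_comp (Function.Involutive.toPerm st hst) f

/-- The logistic reweighting whose LLR is `t` times that of `p`. -/
noncomputable def temper (p : S → ℝ) (st : S → S) (t : ℝ) (a : S) : ℝ :=
  (p a + p (st a)) / (1 + Real.exp (-(t * LLR p st a)))

lemma temper_one {p : S → ℝ} {st : S → S} (hp : ∀ a, 0 < p a) (a : S) :
    temper p st 1 a = p a := by
  have h1 := hp a
  have h2 := hp (st a)
  unfold temper LLR
  rw [one_mul, ← Real.log_inv, Real.exp_log (by positivity), inv_div]
  field_simp

lemma temper_pos {p : S → ℝ} {st : S → S} (hp : ∀ a, 0 < p a) (t : ℝ) (a : S) :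
    0 < temper p st t a := by
  have h1 := hp a
  have h2 := hp (st a)
  unfold temper
  positivity

lemma temper_ratio {p : S → ℝ} {st : S → S} (hst : ∀ a, st (st a) = a) (hp : ∀ a, 0 < p a)
    (t : ℝ) (a : S) :
    temper p st t a / temper p st t (st a) = Real.exp (t * LLR p st a) := by
  have h1 := hp a
  have h2 := hp (st a)
  have he := Real.exp_pos (t * LLR p st a)
  unfold temper
  rw [hst, LLR_involution hst, mul_neg, neg_neg, Real.exp_neg]
  field_simp
  ring

lemma temper_add {p : S → ℝ} {st : S → S} (hst : ∀ a, st (st a) = a)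
    (t : ℝ) (a : S) :
    temper p st t a + temper p st t (st a) = p a + p (st a) := by
  have he := Real.exp_pos (t * LLR p st a)
  unfold temper
  rw [hst, LLR_involution hst, mul_neg, neg_neg, Real.exp_neg]
  field_simp
  ring

lemma temper_sum [Fintype S] {p : S → ℝ} {st : S → S} (hst : ∀ a, st (st a) = a) (t : ℝ) :
    ∑ a, temper p st t a = ∑ a, p a := by
  have h := Finset.sum_congr (s₁ := (univ : Finset S)) rfl fun a _ =>
    temper_add (p := p) hst t a
  rw [Finset.sum_add_distrib, Finset.sum_add_distrib, sum_comp_involution hst,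
    sum_comp_involution hst] at h
  linarith

lemma temper_lt {p : S → ℝ} {st : S → S} (hp : ∀ a, 0 < p a) {t : ℝ} (ht : t < 1) {a : S}
    (ha : 0 < LLR p st a) : temper p st t a < p a := by
  have h1 := hp a
  have h2 := hp (st a)
  conv_rhs => rw [← temper_one (st := st) hp a]
  unfold temper
  have : t * LLR p st a < 1 * LLR p st a := mul_lt_mul_of_pos_right ht ha
  gcongr

lemma lt_temper {p : S → ℝ} {st : S → S} (hp : ∀ a, 0 < p a) {t : ℝ} (ht : t < 1) {a : S}
    (ha : LLR p st a < 0) : p a < temper p st t a := by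
  have h1 := hp a
  have h2 := hp (st a)
  conv_lhs => rw [← temper_one (st := st) hp a]
  unfold temper
  have : 1 * LLR p st a < t * LLR p st a := mul_lt_mul_of_neg_right ht ha
  gcongr

lemma continuous_temper (p : S → ℝ) (st : S → S) (a : S) :
    Continuous fun t => temper p st t a := by
  unfold temper
  refine Continuous.div (by fun_prop) (by fun_prop) fun t => ?_
  positivity

/-- A nearby distribution with proportional LLR which moves mass from the symbols of
nonnegative LLR to those of negative LLR. -/
lemma exists_shifted_distribution [Fintype S] {p : S → ℝ} {st : S → S} (hst : ∀ a, st (st a) = a)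
    (hp : ∀ a, 0 < p a) (hsum : ∑ a, p a = 1) (hne : ∃ a, LLR p st a ≠ 0)
    {α : ℝ} (hα : 0 < α) :
    ∃ (q : S → ℝ) (t : ℝ), 0 < t ∧ (∀ a, 0 < q a) ∧ ∑ a, q a = 1 ∧
      ∑ a, |p a - q a| ≤ α ∧ (∀ a, LLR q st a = t * LLR p st a) ∧
      (∀ a, 0 ≤ LLR p st a → q a < p a) ∧ (∀ a, LLR p st a < 0 → p a < q a) := by
  classical
  obtain ⟨t, ht0, ht1, htα⟩ : ∃ t : ℝ, 0 < t ∧ t < 1 ∧ ∑ a, |p a - temper p st t a| < α := by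
    have hc : Continuous fun t => ∑ a, |p a - temper p st t a| :=
      continuous_finsetSum _ fun a _ => (continuous_const.sub (continuous_temper p st a)).abs
    have h1 : ∀ᶠ t in nhdsWithin (1 : ℝ) (Set.Iio 1), ∑ a, |p a - temper p st t a| < α := by
      refine (hc.continuousAt.eventually_lt continuousAt_const ?_).filter_mono
        nhdsWithin_le_nhds
      simpa [temper_one hp] using hα
    have h2 : ∀ᶠ t in nhdsWithin (1 : ℝ) (Set.Iio 1), (0 : ℝ) < t :=
      (lt_mem_nhds one_pos).filter_mono nhdsWithin_le_nhds
    obtain ⟨t, h⟩ := (h1.and (h2.and self_mem_nhdsWithin)).exists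
    exact ⟨t, h.2.1, h.2.2, h.1⟩
  set Z := ∑ a, if LLR p st a = 0 then p a else 0 with hZ
  set M := ∑ a, if LLR p st a = 0 then 0 else p a with hM
  have hMpos : 0 < M := by
    obtain ⟨a, ha⟩ := hne
    refine Finset.sum_pos' (fun b _ => ?_) ⟨a, mem_univ a, by simp [ha, hp a]⟩
    split_ifs
    · exact le_rfl
    · exact (hp b).le
  have hZ0 : 0 ≤ Z := Finset.sum_nonneg fun b _ => by
    split_ifs
    · exact (hp b).le
    · exact le_rfl
  set f : ℝ → S → ℝ := fun e a => temper p st t a * (if LLR p st a = 0 then 1 - e else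
    1 + e * Z / M) with hf
  have hfc : ∀ a, Continuous fun e => f e a := by
    intro a
    simp only [hf]
    split_ifs <;> fun_prop
  have hf0 : ∀ a, f 0 a = temper p st t a := by intro a; simp [hf]
  have h1 : ∀ᶠ e in nhdsWithin (0 : ℝ) (Set.Ioi 0), ∑ a, |p a - f e a| < α := by
    refine ((continuous_finsetSum univ fun a _ =>
      (continuous_const.sub (hfc a)).abs).continuousAt.eventually_lt continuousAt_const
        ?_).filter_mono nhdsWithin_le_nhds
    simpa [hf0] using htα
  have h2 : ∀ᶠ e in nhdsWithin (0 : ℝ) (Set.Ioi 0), ∀ a, 0 < LLR p st a → f e a < p a := by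
    refine Filter.eventually_all.mpr fun a => ?_
    by_cases ha : 0 < LLR p st a
    · have := ((hfc a).continuousAt (x := 0)).eventually_lt (continuousAt_const (y := p a))
        (by rw [hf0]; exact temper_lt hp ht1 ha)
      filter_upwards [this.filter_mono nhdsWithin_le_nhds] with e he _ using he
    · exact Eventually.of_forall fun e h => absurd h ha
  have h3 : ∀ᶠ e in nhdsWithin (0 : ℝ) (Set.Ioi 0), e < 1 :=
    (gt_mem_nhds one_pos).filter_mono nhdsWithin_le_nhds
  obtain ⟨e, he1, he2, he3, he0⟩ := (h1.and (h2.and (h3.and self_mem_nhdsWithin))).exists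
  have he0 : 0 < e := he0
  have hzero : ∀ a, LLR p st a = 0 → temper p st t a = p a := by
    intro a ha
    rw [← temper_one (st := st) hp a]
    simp [temper, ha]
  have hfac : ∀ a, 0 < (if LLR p st a = 0 then 1 - e else 1 + e * Z / M) := by
    intro a
    split_ifs
    · linarith
    · positivity
  refine ⟨f e, t, ht0, fun a => mul_pos (temper_pos hp t a) (hfac a), ?_, he1.le,
    fun a => ?_, fun a ha => ?_, fun a ha => ?_⟩
  · have hTZ : ∑ a, (if LLR p st a = 0 then temper p st t a else 0) = Z :=
      Finset.sum_congr rfl fun a _ => by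
        split_ifs with h
        · exact hzero a h
        · rfl
    have hZM : Z + M = 1 := by
      rw [← hsum, hZ, hM, ← Finset.sum_add_distrib]
      exact Finset.sum_congr rfl fun a _ => by split_ifs <;> simp
    have hTM : ∑ a, (if LLR p st a = 0 then 0 else temper p st t a) = M := by
      have : ∑ a, (if LLR p st a = 0 then temper p st t a else 0)
          + ∑ a, (if LLR p st a = 0 then 0 else temper p st t a) = 1 := by
        rw [← hsum, ← temper_sum (p := p) hst t, ← Finset.sum_add_distrib]
        exact Finset.sum_congr rfl fun a _ => by split_ifs <;> simp
      linarith
    have : ∑ a, f e a = (∑ a, (if LLR p st a = 0 then temper p st t a else 0)) * (1 - e)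
        + (∑ a, (if LLR p st a = 0 then 0 else temper p st t a)) * (1 + e * Z / M) := by
      rw [Finset.sum_mul, Finset.sum_mul, ← Finset.sum_add_distrib]
      exact Finset.sum_congr rfl fun a _ => by simp only [hf]; split_ifs <;> simp
    rw [this, hTZ, hTM]
    field_simp
    linarith
  · have hfaceq : (if LLR p st (st a) = 0 then 1 - e else 1 + e * Z / M)
        = (if LLR p st a = 0 then 1 - e else 1 + e * Z / M) := by
      rw [LLR_involution hst]; simp
    rw [LLR]
    simp only [hf]
    rw [hfaceq, mul_div_mul_right _ _ (hfac a).ne', temper_ratio hst hp, Real.log_exp]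
  · rcases ha.lt_or_eq with h | h
    · exact he2 a h
    · simp only [hf, ← h, if_true, hzero a h.symm]
      nlinarith [hp a]
  · have := lt_temper hp ht1 ha
    simp only [hf, ha.ne, if_false]
    have h5 : 0 ≤ e * Z / M := by positivity
    nlinarith [hp a]

/-- A stochastic map from `p` to a nearby distribution under which the scaled conditional
expectation of the new LLR is uniformly below the old LLR. -/
lemma exists_degradation [Fintype S] {p : S → ℝ} {st : S → S} (hst : ∀ a, st (st a) = a)
    (hp : ∀ a, 0 < p a) (hsum : ∑ a, p a = 1) (hne : ∃ a, LLR p st a ≠ 0)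
    {α : ℝ} (hα : 0 < α) :
    ∃ (q : S → ℝ) (W : S → S → ℝ) (r c : ℝ), (∀ a, 0 < q a) ∧ ∑ a, q a = 1 ∧
      ∑ a, |p a - q a| ≤ α ∧ (∀ a b, 0 ≤ W a b) ∧ (∀ a, ∑ b, W a b = 1) ∧
      (∀ b, ∑ a, p a * W a b = q b) ∧ 0 < r ∧ 0 < c ∧
      ∀ a, r * ∑ b, W a b * LLR q st b ≤ LLR p st a - c := by
  classical
  obtain ⟨q, t, ht, hq, hqs, hpq, hL, hdown, hup⟩ :=
    exists_shifted_distribution hst hp hsum hne hα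
  set L := LLR p st with hLdef
  obtain ⟨a₀, ha₀⟩ : ∃ a, L a < 0 := by
    obtain ⟨a, ha⟩ := hne
    rcases lt_or_gt_of_ne ha with h | h
    · exact ⟨a, h⟩
    · exact ⟨st a, by rw [hLdef, LLR_involution hst]; linarith⟩
  set g : S → ℝ := fun a => if L a < 0 then q a - p a else 0 with hg
  set β : S → ℝ := fun a => if L a < 0 then 0 else (p a - q a) / p a with hβ
  have hg0 : ∀ a, 0 ≤ g a := by
    intro a; simp only [hg]; split_ifs with h
    · linarith [hup a h]
    · exact le_rfl
  set Z := ∑ a, g a with hZ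
  have hZpos : 0 < Z := Finset.sum_pos' (fun a _ => hg0 a)
    ⟨a₀, mem_univ _, by simp only [hg, ha₀, if_true]; linarith [hup a₀ ha₀]⟩
  have hβp : ∀ a, p a * β a = if L a < 0 then 0 else p a - q a := by
    intro a; simp only [hβ]; split_ifs
    · simp
    · rw [mul_div_cancel₀ _ (hp a).ne']
  have hβ0 : ∀ a, 0 ≤ β a := by
    intro a; simp only [hβ]; split_ifs with h
    · exact le_rfl
    · exact div_nonneg (by linarith [hdown a (not_lt.mp h)]) (hp a).le
  have hβ1 : ∀ a, β a ≤ 1 := by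
    intro a; simp only [hβ]; split_ifs with h
    · exact zero_le_one
    · rw [div_le_one (hp a)]; linarith [hq a]
  have hβZ : ∑ a, p a * β a = Z := by
    have : ∑ a, p a * β a - Z = ∑ a, (p a - q a) := by
      rw [hZ, ← Finset.sum_sub_distrib]
      refine Finset.sum_congr rfl fun a _ => ?_
      rw [hβp]; simp only [hg]; split_ifs <;> ring
    rw [Finset.sum_sub_distrib, hsum, hqs] at this
    linarith
  set W : S → S → ℝ := fun a b => (if a = b then 1 - β a else 0) + β a * (g b / Z) with hW
  set R := ∑ b, g b / Z * L b with hR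
  have hRneg : R < 0 := by
    refine Finset.sum_neg' (fun b _ => ?_) ⟨a₀, mem_univ _, ?_⟩
    · by_cases hb : L b < 0
      · exact mul_nonpos_of_nonneg_of_nonpos (div_nonneg (hg0 b) hZpos.le) hb.le
      · simp [hg, hb]
    · refine mul_neg_of_pos_of_neg (div_pos ?_ hZpos) ha₀
      simp only [hg, ha₀, if_true]; linarith [hup a₀ ha₀]
  set m : S → ℝ := fun a => (1 - β a) * L a + β a * R with hm
  have hmL : ∀ a, ∑ b, W a b * LLR q st b = t * m a := by
    intro a
    simp only [hW, add_mul, Finset.sum_add_distrib, hL, hm, hR, ite_mul, zero_mul,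
      Finset.sum_ite_eq, mem_univ, if_true, mul_add, Finset.mul_sum]
    congr 1
    · ring
    · exact Finset.sum_congr rfl fun b _ => by ring
  obtain ⟨s, hs⟩ : ∃ s : ℝ, 0 < s ∧ ∀ a, (1 + s) * m a < L a := by
    have h : ∀ᶠ s in nhdsWithin (0 : ℝ) (Set.Ioi 0), ∀ a, (1 + s) * m a < L a := by
      refine Filter.eventually_all.mpr fun a => ?_
      by_cases ha : L a < 0
      · filter_upwards [self_mem_nhdsWithin] with s hs
        have hs : 0 < s := hs
        have : m a = L a := by simp [hm, hβ, ha]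
        rw [this]; nlinarith
      · have hmlt : m a < L a := by
          have hβpos : 0 < β a := by
            simp only [hβ, ha, if_false]
            exact div_pos (by linarith [hdown a (not_lt.mp ha)]) (hp a)
          simp only [hm]
          nlinarith [mul_nonneg hβpos.le (not_lt.mp ha), mul_pos hβpos (neg_pos.mpr hRneg)]
        have hc : Continuous fun s : ℝ => (1 + s) * m a := by fun_prop
        exact (hc.continuousAt.eventually_lt continuousAt_const
          (by simpa using hmlt)).filter_mono nhdsWithin_le_nhds
    obtain ⟨s, h1, h2⟩ := (h.and self_mem_nhdsWithin).exists
    exact ⟨s, h2, h1⟩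
  obtain ⟨c, hc0, hc⟩ : ∃ c : ℝ, 0 < c ∧ ∀ a, c < L a - (1 + s) * m a := by
    have h : ∀ᶠ c in nhdsWithin (0 : ℝ) (Set.Ioi 0), ∀ a, c < L a - (1 + s) * m a :=
      Filter.eventually_all.mpr fun a =>
        (gt_mem_nhds (sub_pos.mpr (hs.2 a))).filter_mono nhdsWithin_le_nhds
    obtain ⟨c, h1, h2⟩ := (h.and self_mem_nhdsWithin).exists
    exact ⟨c, h2, h1⟩
  refine ⟨q, W, (1 + s) / t, c, hq, hqs, hpq, fun a b => ?_, fun a => ?_, fun b => ?_,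
    div_pos (by linarith [hs.1]) ht, hc0, fun a => ?_⟩
  · have h1 := hβ1 a
    have h2 : 0 ≤ β a * (g b / Z) := mul_nonneg (hβ0 a) (div_nonneg (hg0 b) hZpos.le)
    simp only [hW]
    split_ifs <;> linarith
  · simp only [hW, Finset.sum_add_distrib, Finset.sum_ite_eq, mem_univ, if_true,
      ← Finset.mul_sum, ← Finset.sum_div]
    rw [← hZ, div_self hZpos.ne']
    ring
  · have : ∑ a, p a * W a b = (p b - p b * β b) + (∑ a, p a * β a) * (g b / Z) := by
      simp only [hW, mul_add, Finset.sum_add_distrib, mul_ite, mul_zero, Finset.sum_ite_eq',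
        mem_univ, if_true, Finset.sum_mul]
      congr 1
      · ring
      · exact Finset.sum_congr rfl fun a _ => by ring
    rw [this, hβZ, mul_div_cancel₀ _ hZpos.ne', hβp]
    simp only [hg]
    split_ifs <;> ring
  · rw [hmL, div_mul_eq_mul_div, mul_left_comm, mul_div_cancel_left₀ _ ht.ne']
    linarith [hc a]

end Degradation

section Averaging

variable {S : Type*} [Fintype S] {n : ℕ}

lemma sum_pi_prod (f : Fin n → S → ℝ) :
    ∑ y : Fin n → S, ∏ i, f i (y i) = ∏ i, ∑ b, f i b := by
  classical
  rw [Finset.prod_univ_sum, Fintype.piFinset_univ]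

lemma sum_pi_prod_eq_one {f : Fin n → S → ℝ} (hf : ∀ i, ∑ b, f i b = 1) :
    ∑ y : Fin n → S, ∏ i, f i (y i) = 1 := by
  rw [sum_pi_prod, Finset.prod_eq_one fun i _ => hf i]

/-- Expectation of a function of one coordinate under a product distribution. -/
lemma sum_pi_prod_mul_coord {f : Fin n → S → ℝ} (hf : ∀ i, ∑ b, f i b = 1) (i₀ : Fin n)
    (g : S → ℝ) :
    ∑ y : Fin n → S, (∏ i, f i (y i)) * g (y i₀) = ∑ b, f i₀ b * g b := by
  classical
  have h : ∀ y : Fin n → S, (∏ i, f i (y i)) * g (y i₀)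
      = ∏ i, (f i (y i) * if i = i₀ then g (y i) else 1) := by
    intro y
    rw [Finset.prod_mul_distrib, Finset.prod_ite_eq' univ i₀ fun i => g (y i)]
    simp
  rw [Finset.sum_congr rfl fun y _ => h y,
    sum_pi_prod fun i b => f i b * if i = i₀ then g b else 1,
    Finset.prod_eq_single i₀ (fun i _ hi => by simp [hi, hf]) (by simp)]
  simp

/-- Pushing a product distribution through a memoryless stochastic map. -/
lemma sum_pi_prod_kernel {p q : S → ℝ} {W : S → S → ℝ}
    (hW : ∀ b, ∑ a, p a * W a b = q b) (F : (Fin n → S) → ℝ) :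
    ∑ y : Fin n → S, (∏ i, p (y i)) * ∑ y' : Fin n → S, (∏ i, W (y i) (y' i)) * F y'
      = ∑ y' : Fin n → S, (∏ i, q (y' i)) * F y' := by
  simp_rw [Finset.mul_sum]
  rw [Finset.sum_comm]
  refine Finset.sum_congr rfl fun y' _ => ?_
  simp_rw [← mul_assoc, ← Finset.prod_mul_distrib]
  rw [← Finset.sum_mul, sum_pi_prod fun i a => p a * W a (y' i)]
  simp_rw [hW]

lemma llrProb_add_compl {p : S → ℝ} {st : S → S} (hsum : ∑ a, p a = 1)
    (C : Set (Fin n → ℝ)) : llrProb p st C + llrProb p st Cᶜ = 1 := by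
  classical
  unfold llrProb
  rw [← Finset.sum_add_distrib]
  refine Eq.trans (Finset.sum_congr rfl fun y _ => ?_)
    (sum_pi_prod_eq_one (n := n) fun _ => hsum)
  rw [← mul_add]
  by_cases h : (fun i => LLR p st (y i)) ∈ C <;> simp [h]

lemma llrProb_nonneg {p : S → ℝ} {st : S → S} (hp : ∀ a, 0 < p a)
    (C : Set (Fin n → ℝ)) : 0 ≤ llrProb p st C :=
  Finset.sum_nonneg fun _ _ => mul_nonneg (Finset.prod_nonneg fun _ _ => (hp _).le)
    (Set.indicator_nonneg (fun _ _ => zero_le_one) _)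

/-- Markov's inequality for the conditional failure probability of the degraded channel. -/
lemma llrProb_compl_le {p q : S → ℝ} {st : S → S} {W : S → S → ℝ} (hp : ∀ a, 0 < p a)
    (hW0 : ∀ a b, 0 ≤ W a b) (hW : ∀ b, ∑ a, p a * W a b = q b)
    {A C : Set (Fin n → ℝ)} {ρ : ℝ} (hρ : 0 < ρ)
    (hAC : ∀ y : Fin n → S, ∑ y' : Fin n → S, (∏ i, W (y i) (y' i)) *
      Set.indicator Aᶜ (fun _ => (1 : ℝ)) (fun i => LLR q st (y' i)) ≤ ρ →
        (fun i => LLR p st (y i)) ∈ C) :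
    llrProb p st Cᶜ ≤ llrProb q st Aᶜ / ρ := by
  classical
  unfold llrProb
  rw [← sum_pi_prod_kernel hW fun y' => Set.indicator Aᶜ (fun _ => (1 : ℝ))
    (fun i => LLR q st (y' i)), Finset.sum_div]
  refine Finset.sum_le_sum fun y _ => ?_
  rw [mul_div_assoc]
  refine mul_le_mul_of_nonneg_left ?_ (Finset.prod_nonneg fun i _ => (hp _).le)
  by_cases hy : (fun i => LLR p st (y i)) ∈ C
  · rw [Set.indicator_of_notMem (by simpa using hy)]
    exact div_nonneg (Finset.sum_nonneg fun y' _ => mul_nonneg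
      (Finset.prod_nonneg fun i _ => hW0 _ _)
      (Set.indicator_nonneg (fun _ _ => zero_le_one) _)) hρ.le
  · rw [Set.indicator_of_mem (by simpa using hy), one_le_div hρ]
    exact (not_le.mp fun h => hy (hAC y h)).le

/-- If the decoder succeeds on the degraded channel with high conditional probability, the
original LLR vector is nonnegative on the polytope, with a margin. -/
lemma margin_of_conditional_success {p q : S → ℝ} {st : S → S} {W : S → S → ℝ}
    (hW0 : ∀ a b, 0 ≤ W a b) (hW1 : ∀ a, ∑ b, W a b = 1) {r c B ρ : ℝ} (hr : 0 < r)
    (hWL : ∀ a, r * ∑ b, W a b * LLR q st b ≤ LLR p st a - c)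
    (hB : ∀ b, |LLR q st b| ≤ B) (hB0 : 0 ≤ B) (hρ : r * (B * ρ) ≤ c / 2)
    {P : Set (Fin n → ℝ)} (hP : ∀ x ∈ P, ∀ i, 0 ≤ x i) (y : Fin n → S)
    (hy : ∑ y' : Fin n → S, (∏ i, W (y i) (y' i)) *
      Set.indicator {l : Fin n → ℝ | LPsucceeds P l}ᶜ (fun _ => (1 : ℝ))
        (fun i => LLR q st (y' i)) ≤ ρ) :
    ∀ x ∈ P, 0 ≤ ∑ i, x i * (LLR p st (y i) - c / 2) := by
  classical
  intro x hx
  set A := {l : Fin n → ℝ | LPsucceeds P l} with hA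
  set w : (Fin n → S) → ℝ := fun y' => ∏ i, W (y i) (y' i) with hw
  have hw0 : ∀ y', 0 ≤ w y' := fun y' => Finset.prod_nonneg fun i _ => hW0 _ _
  set good : (Fin n → S) → ℝ := fun y' =>
    Set.indicator A (fun _ => (1 : ℝ)) (fun i => LLR q st (y' i)) with hgood
  set bad : (Fin n → S) → ℝ := fun y' =>
    Set.indicator Aᶜ (fun _ => (1 : ℝ)) (fun i => LLR q st (y' i)) with hbad
  have hgb : ∀ y', good y' = 1 - bad y' := by
    intro y'
    by_cases h : (fun i => LLR q st (y' i)) ∈ A <;> simp [hgood, hbad, h]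
  have hbad0 : ∀ y', 0 ≤ bad y' := fun y' => Set.indicator_nonneg (fun _ _ => zero_le_one) _
  have hcoord : ∀ i, r * ∑ y', w y' * good y' * LLR q st (y' i)
      ≤ LLR p st (y i) - c / 2 := by
    intro i
    have h1 : ∑ y', w y' * LLR q st (y' i) = ∑ b, W (y i) b * LLR q st b :=
      sum_pi_prod_mul_coord (f := fun i b => W (y i) b) (fun i => hW1 (y i)) i (LLR q st)
    have h2 : ∑ y', w y' * good y' * LLR q st (y' i)
        = ∑ y', w y' * LLR q st (y' i) - ∑ y', w y' * bad y' * LLR q st (y' i) := by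
      rw [← Finset.sum_sub_distrib]
      exact Finset.sum_congr rfl fun y' _ => by rw [hgb]; ring
    have h3 : -∑ y', w y' * bad y' * LLR q st (y' i) ≤ B * ρ := by
      rw [← Finset.sum_neg_distrib]
      calc _ ≤ ∑ y', w y' * bad y' * B := Finset.sum_le_sum fun y' _ => by
            rw [← mul_neg]
            exact mul_le_mul_of_nonneg_left ((neg_le_abs _).trans (hB _))
              (mul_nonneg (hw0 y') (hbad0 y'))
        _ = B * ∑ y', w y' * bad y' := by rw [← Finset.sum_mul, mul_comm]
        _ ≤ B * ρ := mul_le_mul_of_nonneg_left hy hB0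
    have h4 := hWL (y i)
    rw [h2, h1]
    nlinarith [mul_le_mul_of_nonneg_left h3 hr.le]
  calc (0 : ℝ) ≤ r * ∑ y', w y' * good y' * ∑ i, x i * LLR q st (y' i) := by
        refine mul_nonneg hr.le (Finset.sum_nonneg fun y' _ => ?_)
        by_cases h : (fun i => LLR q st (y' i)) ∈ A
        · have hx' : 0 ≤ ∑ i, x i * LLR q st (y' i) := by
            by_cases hx0 : x = 0
            · simp [hx0]
            · exact (h x hx hx0).le
          exact mul_nonneg (mul_nonneg (hw0 y')
            (Set.indicator_nonneg (fun _ _ => zero_le_one) _)) hx'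
        · simp [hgood, h]
    _ = ∑ i, x i * (r * ∑ y', w y' * good y' * LLR q st (y' i)) := by
        simp only [Finset.mul_sum]
        rw [Finset.sum_comm]
        exact Finset.sum_congr rfl fun i _ => Finset.sum_congr rfl fun y' _ => by ring
    _ ≤ _ := Finset.sum_le_sum fun i _ =>
        mul_le_mul_of_nonneg_left (hcoord i) (hP x hx i)

/-- If the polytope of all dual checks is trivial, so is that of dual checks of weight one. -/
lemma LPsucceeds_of_trivial_polytope {H : Set (Fin n → ZMod 2)} {k : ℕ} (hk : 1 ≤ k)
    (hH : ∀ x ∈ feldmanPolytope (allDualChecks H), x = 0) (l : Fin n → ℝ) :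
    LPsucceeds (feldmanPolytope (dualChecksLe H k)) l := by
  have hcode : ∀ x ∈ tannerCode H, x = 0 := by
    intro x hx
    have h0 := hH (toRealVec x) (Set.mem_iInter₂.mpr fun h hh =>
      subset_convexHull ℝ _ ⟨x, rfl, hh.2 x hx⟩)
    ext i
    by_contra hi
    have := congrFun h0 i
    rw [toRealVec_eq_ite] at this
    simp_all
  intro x hx hx0
  refine absurd ?_ hx0
  ext i
  have hmem : (Pi.single i 1 : Fin n → ZMod 2) ∈ dualChecksLe H k := by
    refine ⟨⟨by simp, fun x hx => by simp [hcode x hx]⟩, le_trans ?_ hk⟩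
    refine (Finset.card_le_card (t := {i}) fun j hj => ?_).trans (by simp)
    by_contra hji
    simp_all
  have hlocal := local_polytope_inequalities (Set.mem_iInter₂.mp hx _ hmem)
  have hsupp : checkSupp (Pi.single i 1 : Fin n → ZMod 2) = {i} := by
    ext j
    simp [mem_checkSupp, Pi.single_apply]
  have := hlocal.2.2 i (by simp [hsupp])
  rw [hsupp] at this
  simp only [Finset.erase_singleton, Finset.sum_empty] at this
  exact le_antisymm this (hlocal.1 i)

end Averaging

/-- **Bounded-weight redundant checks suffice on discrete MSB channels.**
Let `G` be an asymptotically strong family of Tanner graphs of bounded check degree `d`.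
If there is an `α > 0` such that for every `α`-distortion of the discrete MSB channel
`(S, p, st)` the `P(Ḡ_n)`-LP decoder succeeds with high probability, then there is a
constant `k ≥ d` (depending only on `α` and the channel, not on `n`) such that the
`P(Ḡ_n^k)`-LP decoder succeeds on `(S, p, st)` with high probability. -/
theorem bounded_weight_redundant_checks_msb {S : Type*} [Fintype S]
    (p : S → ℝ) (st : S → S)
    (hst : ∀ a, st (st a) = a)
    (hp_pos : ∀ a, 0 < p a) (hp_sum : ∑ a, p a = 1)
    (d : ℕ) (G : ∀ n : ℕ, Set (Fin n → ZMod 2))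
    (hG : ∀ n, ∀ h ∈ G n, h ≠ 0 ∧ hammingNorm h ≤ d)
    (hstrong : AsympStrong G)
    (hα : ∃ α > (0 : ℝ), ∀ p' : S → ℝ,
      (∀ a, 0 < p' a) → (∑ a, p' a = 1) → (∑ a, |p a - p' a|) ≤ α →
      Tendsto (fun n => llrProb p' st
          {l : Fin n → ℝ | LPsucceeds (feldmanPolytope (allDualChecks (G n))) l})
        atTop (nhds 1)) :
    ∃ k ≥ d, Tendsto (fun n => llrProb p st
        {l : Fin n → ℝ | LPsucceeds (feldmanPolytope (dualChecksLe (G n) k)) l})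
      atTop (nhds 1) := by
  classical
  obtain ⟨α, hα0, hα⟩ := hα
  by_cases hne : ∃ a, LLR p st a ≠ 0
  · obtain ⟨q, W, r, c, hq, hqs, hpq, hW0, hW1, hW, hr, hc, hWL⟩ :=
      exists_degradation hst hp_pos hp_sum hne hα0
    have hlim := hα q hq hqs hpq
    set B' := ∑ b, |LLR q st b| with hB'
    have hB'0 : 0 ≤ B' := Finset.sum_nonneg fun _ _ => abs_nonneg _
    have hB'b : ∀ b, |LLR q st b| ≤ B' := fun b =>
      Finset.single_le_sum (f := fun b => |LLR q st b|) (fun _ _ => abs_nonneg _) (mem_univ b)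
    set ρ := c / (2 * (r * B' + 1)) with hρ
    have hρ0 : 0 < ρ := by positivity
    have hρc : r * (B' * ρ) ≤ c / 2 := by
      have : r * (B' * ρ) = (r * B' / (r * B' + 1)) * (c / 2) := by
        rw [hρ]; field_simp
      rw [this]
      have h1 : r * B' / (r * B' + 1) ≤ 1 := (div_le_one (by positivity)).mpr (by linarith)
      nlinarith
    set B := ∑ a, |LLR p st a| + c / 2 with hB
    have hB0 : 0 ≤ B := by
      have : 0 ≤ ∑ a, |LLR p st a| := Finset.sum_nonneg fun _ _ => abs_nonneg _
      positivity
    have hBb : ∀ a, |LLR p st a - c / 2| ≤ B := fun a => by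
      have h1 := Finset.single_le_sum (f := fun b => |LLR p st b|)
        (fun _ _ => abs_nonneg _) (mem_univ a)
      have h2 := abs_sub (LLR p st a) (c / 2)
      rw [abs_of_pos (half_pos hc)] at h2
      exact h2.trans (by rw [hB]; gcongr)
    set η := c / (8 * (B + 1)) with hη
    have hη0 : 0 < η := by positivity
    have hmargin : B * (min η 1 + η) < c / 2 := by
      have h1 : B * (min η 1 + η) ≤ B * (η + η) := by gcongr; exact min_le_left _ _
      have h2 : (B + 1) * (η + η) = c / 4 := by rw [hη]; field_simp; norm_num
      nlinarith
    obtain ⟨δ, hδ, N, hN⟩ := hstrong (min η 1) (lt_min hη0 one_pos) (min_le_right _ _)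
    set k := max d ⌈1 / (δ * η)⌉₊ with hk
    have hkδ : 1 ≤ δ * (k * η) := by
      have h1 : 1 / (δ * η) ≤ k :=
        (Nat.le_ceil _).trans (by exact_mod_cast le_max_right _ _)
      rw [div_le_iff₀ (by positivity)] at h1
      linarith
    refine ⟨k, le_max_left _ _, ?_⟩
    have hlower : Tendsto (fun n => 1 - (1 - llrProb q st
        {l : Fin n → ℝ | LPsucceeds (feldmanPolytope (allDualChecks (G n))) l}) / ρ)
        atTop (nhds 1) := by
      simpa using ((hlim.const_sub 1).div_const ρ).const_sub 1
    refine tendsto_of_tendsto_of_tendsto_of_le_of_le' hlower tendsto_const_nhds ?_ ?_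
    · filter_upwards [eventually_ge_atTop N] with n hn
      have hbase := hN n hn ∅ (by simpa using by positivity)
      have hle := llrProb_compl_le (st := st) (n := n) hp_pos hW0 hW
        (A := {l : Fin n → ℝ | LPsucceeds (feldmanPolytope (allDualChecks (G n))) l})
        (C := {l : Fin n → ℝ | LPsucceeds (feldmanPolytope (dualChecksLe (G n) k)) l}) hρ0
        (fun y hy => LPsucceeds_of_margin (le_max_left _ _) (hG n) (lt_min hη0 one_pos) hη0
          hB0 hmargin hkδ (hN n hn) (fun i => hBb (y i))
          (margin_of_conditional_success hW0 hW1 hr hWL hB'b hB'0 hρc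
            (fun x hx => (mem_cube_of_LPsucceeds hbase (feldmanPolytope_anti
              (subset_allDualChecks fun h hh => (hG n h hh).1) hx)).1) y hy))
      have h1 := llrProb_add_compl (st := st) hp_sum
        {l : Fin n → ℝ | LPsucceeds (feldmanPolytope (dualChecksLe (G n) k)) l}
      have h2 := llrProb_add_compl (st := st) hqs
        {l : Fin n → ℝ | LPsucceeds (feldmanPolytope (allDualChecks (G n))) l}
      rw [← h2, add_sub_cancel_left]
      linarith
    · refine Eventually.of_forall fun n => ?_
      have h1 := llrProb_add_compl (st := st) hp_sum
        {l : Fin n → ℝ | LPsucceeds (feldmanPolytope (dualChecksLe (G n) k)) l}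
      have h2 := llrProb_nonneg (st := st) hp_pos
        {l : Fin n → ℝ | LPsucceeds (feldmanPolytope (dualChecksLe (G n) k)) l}ᶜ
      linarith
  · push Not at hne
    have hlim := hα p hp_pos hp_sum (by simpa using hα0.le)
    refine ⟨max d 1, le_max_left _ _, tendsto_const_nhds.congr' ?_⟩
    filter_upwards [hlim.eventually (lt_mem_nhds one_pos)] with n hn
    have htriv : ∀ x ∈ feldmanPolytope (allDualChecks (G n)), x = 0 := by
      intro x hx
      by_contra hx0
      have : llrProb p st
          {l : Fin n → ℝ | LPsucceeds (feldmanPolytope (allDualChecks (G n))) l} = 0 := by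
        refine Finset.sum_eq_zero fun y _ => ?_
        rw [Set.indicator_of_notMem, mul_zero]
        intro h
        have := h x hx hx0
        simp [hne] at this
      exact hn.ne' this
    unfold llrProb
    refine (sum_pi_prod_eq_one (n := n) fun _ => hp_sum).symm.trans
      (Finset.sum_congr rfl fun y _ => ?_)
    rw [Set.indicator_of_mem, mul_one]
    exact LPsucceeds_of_trivial_polytope (le_max_right _ _) htriv _
end
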